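/- arXiv:2604.12853 — 3 statements merged into one kernel-verified Lean document; each statement's English description precedes it below -/
import Mathlib

section
/- Let X̄, Ȳ, Z̄ be time-homogeneous Markov chains with time indexed by ℕ and countable state spaces A, B, C respectively, and let f: A → C and g: B → C be maps such that f(X̄) =ᵈ Z̄ =ᵈ g(Ȳ). Then there exists a time-homogeneous Markov chain W = (X_t, Y_t)_{t≥0} taking values in A×B such that (X_t)_{t≥0} =ᵈ X̄, (Y_t)_{t≥0} =ᵈ Ȳ, almost surely f(X_t) = g(Y_t) for all t ≥ 0, and moreover W may be chosen so that the processes X and Y are conditionally independent given the process (f(X_t))_{t≥0}. -/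
open MeasureTheory Filter Topology
open scoped ENNReal Classical

/-- A probability vector on a countable state space. -/
def IsProbVec {U : Type*} (v : U → ℝ≥0∞) : Prop := ∑' u, v u = 1

/-- A row-stochastic matrix on a countable state space. -/
def IsStochastic {U : Type*} (P : U → U → ℝ≥0∞) : Prop := ∀ u, ∑' w, P u w = 1

/-- `μ` is the law on path space of the time-homogeneous Markov chain `MC(v,P)`:
its cylinder probabilities are given by the initial distribution and transition matrix. -/
def IsMarkovChain {U : Type*} [MeasurableSpace U]
    (v : U → ℝ≥0∞) (P : U → U → ℝ≥0∞) (μ : Measure (ℕ → U)) : Prop :=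
  IsProbabilityMeasure μ ∧ IsProbVec v ∧ IsStochastic P ∧
    ∀ (k : ℕ) (a : ℕ → U),
      μ {ω | ∀ i ≤ k, ω i = a i} = v (a 0) * ∏ i ∈ Finset.range k, P (a i) (a (i + 1))

noncomputable def indic {Ω : Type*} (s : Set Ω) : Ω → ℝ := s.indicator fun _ => 1

/-- `X` and `Y` are conditionally independent given `Z` under `μ`. -/
def CondIndepGiven {Ω : Type*} [MeasurableSpace Ω] (μ : Measure Ω)
    {γ α β : Type*} [MeasurableSpace γ] [MeasurableSpace α] [MeasurableSpace β]
    (Z : Ω → γ) (X : Ω → α) (Y : Ω → β) : Prop :=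
  ∀ s t : Set Ω,
    MeasurableSet[MeasurableSpace.comap X inferInstance] s →
    MeasurableSet[MeasurableSpace.comap Y inferInstance] t →
    μ[indic (s ∩ t)|MeasurableSpace.comap Z inferInstance]
      =ᵐ[μ] μ[indic s|MeasurableSpace.comap Z inferInstance]
              * μ[indic t|MeasurableSpace.comap Z inferInstance]

namespace MarkovCoupling

open ProbabilityTheory

/-- The cylinder of paths that agree with `a` up to time `n`. -/
def cyl {U : Type*} (n : ℕ) (a : ℕ → U) : Set (ℕ → U) := {ω | ∀ i ≤ n, ω i = a i}

/-- The time shift by `n`. -/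
def shift {U : Type*} (n : ℕ) (ω : ℕ → U) : ℕ → U := fun i => ω (i + n)

/-- The path that follows `a` before time `n` and then `ω`. -/
def glue {U : Type*} (n : ℕ) (a ω : ℕ → U) : ℕ → U := fun i => if i < n then a i else ω (i - n)

section Paths

variable {U : Type*}

lemma cyl_succ_subset (n : ℕ) (a : ℕ → U) : cyl (n + 1) a ⊆ cyl n a :=
  fun _ h i hi => h i (by omega)

lemma cyl_congr {n : ℕ} {a b : ℕ → U} (h : ∀ i ≤ n, a i = b i) : cyl n a = cyl n b := by
  ext ω
  exact forall₂_congr fun i hi => by rw [h i hi]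

lemma glue_shift {n : ℕ} {a ω : ℕ → U} (h : ω ∈ cyl n a) : glue n a (shift n ω) = ω := by
  funext i
  by_cases hi : i < n
  · simp [glue, hi, h i hi.le]
  · simp [glue, shift, hi, Nat.sub_add_cancel (not_lt.1 hi)]

lemma cyl_inter_shift {n k : ℕ} {a d : ℕ → U} (h : d 0 = a n) :
    cyl n a ∩ shift n ⁻¹' cyl k d = cyl (n + k) (glue n a d) := by
  ext ω
  constructor
  · rintro ⟨h1, h2⟩ i hi
    by_cases hin : i < n
    · simp [glue, hin, h1 i hin.le]
    · have := h2 (i - n) (by omega)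
      simpa [glue, shift, hin, Nat.sub_add_cancel (not_lt.1 hin)] using this
  · intro hω
    refine ⟨fun i hi => ?_, fun i hi => ?_⟩
    · rw [hω i (by omega)]
      rcases hi.lt_or_eq with hi | rfl
      · simp [glue, hi]
      · simp [glue, h]
    · simp [shift, hω (i + n) (by omega), glue]

lemma cyl_inter_shift_of_ne {n k : ℕ} {a d : ℕ → U} (h : d 0 ≠ a n) :
    cyl n a ∩ shift n ⁻¹' cyl k d = ∅ := by
  ext ω
  simp only [Set.mem_inter_iff, Set.mem_empty_iff_false, iff_false, not_and]
  intro h1 h2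
  have := h2 0 (Nat.zero_le _)
  simp only [shift, zero_add] at this
  exact h (this.symm.trans (h1 n le_rfl))

variable [MeasurableSpace U]

lemma measurableSet_cyl [MeasurableSingletonClass U] (n : ℕ) (a : ℕ → U) :
    MeasurableSet (cyl n a) := by
  have : cyl n a = ⋂ i, ⋂ (_ : i ≤ n), (fun ω : ℕ → U => ω i) ⁻¹' {a i} := by
    ext ω; simp [cyl]
  rw [this]
  exact MeasurableSet.iInter fun i => MeasurableSet.iInter fun _ =>
    measurable_pi_apply i (measurableSet_singleton _)

lemma measurable_shift (n : ℕ) : Measurable (shift n : (ℕ → U) → ℕ → U) :=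
  measurable_pi_lambda _ fun i => measurable_pi_apply (i + n)

lemma measurable_glue (n : ℕ) (a : ℕ → U) : Measurable (glue n a) := by
  refine measurable_pi_lambda _ fun i => ?_
  by_cases hi : i < n
  · simp [glue, hi]
  · simpa [glue, hi] using measurable_pi_apply (i - n)

/-- Finite measures on path space that agree on cylinders are equal. -/
lemma ext_of_cyl [Countable U] [MeasurableSingletonClass U] {μ ν : Measure (ℕ → U)}
    [IsFiniteMeasure μ] (h : ∀ n a, μ (cyl n a) = ν (cyl n a)) : μ = ν := by
  have key : ∀ n : ℕ, μ.map (Preorder.frestrictLe n) = ν.map (Preorder.frestrictLe n) := by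
    intro n
    refine Measure.ext_of_singleton fun a => ?_
    have hm : Measurable (Preorder.frestrictLe (π := fun _ : ℕ => U) n) := by fun_prop
    rw [Measure.map_apply hm (measurableSet_singleton _),
      Measure.map_apply hm (measurableSet_singleton _)]
    have : (Preorder.frestrictLe (π := fun _ : ℕ => U) n) ⁻¹' {a}
        = cyl n (fun i => a ⟨min i n, by simp⟩) := by
      ext ω
      simp only [Set.mem_preimage, Set.mem_singleton_iff, cyl, Set.mem_ofPred_eq]
      constructor
      · rintro rfl i hi
        simp [Preorder.frestrictLe_apply, hi]
      · intro hω
        funext ⟨i, hi⟩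
        have hi' : i ≤ n := by simpa using hi
        simp [Preorder.frestrictLe_apply, hω i hi', hi']
    rw [this, h]
  refine IsProjectiveLimit.unique (P := fun I => μ.map I.restrict) (fun I => rfl) fun I => ?_
  have hI : I ⊆ Finset.Iic (I.sup id) := fun i hi => by
    simpa using Finset.le_sup (f := id) hi
  have hc : (I.restrict : (ℕ → U) → _)
      = Finset.restrict₂ (π := fun _ => U) hI ∘ Preorder.frestrictLe (I.sup id) := rfl
  change ν.map I.restrict = μ.map I.restrict
  rw [hc, ← Measure.map_map (by fun_prop) (by fun_prop), ← key,
    Measure.map_map (by fun_prop) (by fun_prop)]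

end Paths

section Markov

variable {U : Type*} [MeasurableSpace U] {v : U → ℝ≥0∞} {P : U → U → ℝ≥0∞} {μ : Measure (ℕ → U)}

lemma measure_cyl (hμ : IsMarkovChain v P μ) (n : ℕ) (a : ℕ → U) :
    μ (cyl n a) = v (a 0) * ∏ i ∈ Finset.range n, P (a i) (a (i + 1)) := hμ.2.2.2 n a

lemma measure_cyl_succ (hμ : IsMarkovChain v P μ) (n : ℕ) (a : ℕ → U) :
    μ (cyl (n + 1) a) = μ (cyl n a) * P (a n) (a (n + 1)) := by
  rw [measure_cyl hμ, measure_cyl hμ, Finset.prod_range_succ, mul_assoc]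

lemma transition_ne_top (hμ : IsMarkovChain v P μ) (u w : U) : P u w ≠ ∞ :=
  ne_top_of_le_ne_top ENNReal.one_ne_top ((hμ.2.2.1 u) ▸ ENNReal.le_tsum w)

lemma measure_cyl_inter_shift_cyl (hμ : IsMarkovChain v P μ) (n k : ℕ) (a d : ℕ → U) :
    μ (cyl n a ∩ shift n ⁻¹' cyl k d) = μ (cyl n a) *
      if d 0 = a n then ∏ i ∈ Finset.range k, P (d i) (d (i + 1)) else 0 := by
  by_cases h : d 0 = a n
  · rw [cyl_inter_shift h, measure_cyl hμ, measure_cyl hμ, if_pos h, Finset.prod_range_add,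
      ← mul_assoc]
    have hg : ∀ i ≤ n, glue n a d i = a i := by
      intro i hi
      rcases hi.lt_or_eq with hi | rfl
      · simp [glue, hi]
      · simp [glue, h]
    have hg' : ∀ i, glue n a d (n + i) = d i := fun i => by simp [glue]
    have h1 : ∏ i ∈ Finset.range n, P (glue n a d i) (glue n a d (i + 1))
        = ∏ i ∈ Finset.range n, P (a i) (a (i + 1)) :=
      Finset.prod_congr rfl fun i hi => by
        rw [hg i (Finset.mem_range.1 hi).le, hg (i + 1) (Finset.mem_range.1 hi)]
    have h2 : ∏ i ∈ Finset.range k, P (glue n a d (n + i)) (glue n a d (n + i + 1))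
        = ∏ i ∈ Finset.range k, P (d i) (d (i + 1)) :=
      Finset.prod_congr rfl fun i _ => by rw [hg', add_assoc, hg']
    rw [h1, h2, hg 0 (Nat.zero_le _)]
  · rw [cyl_inter_shift_of_ne h, if_neg h]
    simp

/-- The Markov property: the future after `n` steps depends on the past only through the
current state. -/
lemma exists_future [Countable U] [MeasurableSingletonClass U] (hμ : IsMarkovChain v P μ) :
    ∃ L : U → Measure (ℕ → U), (∀ u, IsFiniteMeasure (L u)) ∧
      ∀ n a, (μ.restrict (cyl n a)).map (shift n) = μ (cyl n a) • L (a n) := by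
  have := hμ.1
  have key : ∀ u, ∃ L : Measure (ℕ → U), IsFiniteMeasure L ∧ ∀ n a, a n = u →
      (μ.restrict (cyl n a)).map (shift n) = μ (cyl n a) • L := by
    intro u
    by_cases hu : ∃ n a, a n = u ∧ μ (cyl n a) ≠ 0
    · obtain ⟨m, b, rfl, hb⟩ := hu
      refine ⟨(μ (cyl m b))⁻¹ • (μ.restrict (cyl m b)).map (shift m),
        Measure.smul_finite _ (ENNReal.inv_ne_top.2 hb), fun n a ha => ext_of_cyl fun k d => ?_⟩
      have hc := measurable_shift (U := U) n (measurableSet_cyl k d)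
      have hc' := measurable_shift (U := U) m (measurableSet_cyl k d)
      rw [Measure.smul_apply, Measure.smul_apply, Measure.map_apply (measurable_shift _)
        (measurableSet_cyl k d), Measure.map_apply (measurable_shift _) (measurableSet_cyl k d),
        Measure.restrict_apply hc, Measure.restrict_apply hc', Set.inter_comm,
        measure_cyl_inter_shift_cyl hμ, Set.inter_comm, measure_cyl_inter_shift_cyl hμ, ha,
        smul_eq_mul, smul_eq_mul, ← mul_assoc (μ (cyl m b))⁻¹,
        ENNReal.inv_mul_cancel hb (measure_ne_top _ _), one_mul]
    · push Not at hu
      refine ⟨0, inferInstance, fun n a ha => ?_⟩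
      rw [Measure.restrict_eq_zero.2 (hu n a ha)]
      simp
  choose L hL hL' using key
  exact ⟨L, hL, fun n a => hL' _ n a rfl⟩

/-- A process whose cylinder probabilities are multiplicative along steps is a Markov chain. -/
lemma exists_isMarkovChain [Countable U] [MeasurableSingletonClass U] [IsProbabilityMeasure μ]
    (p : U → U → ℝ≥0∞) (hp : ∀ n a, μ (cyl (n + 1) a) = μ (cyl n a) * p (a n) (a (n + 1))) :
    ∃ v P, IsMarkovChain v P μ := by
  refine ⟨fun u => μ (cyl 0 fun _ => u), fun u w => if ∃ n a, a n = u ∧ μ (cyl n a) ≠ 0 then p u w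
    else if w = u then 1 else 0, inferInstance, ?_, fun u => ?_, fun n a => ?_⟩
  · have hU : ⋃ u : U, cyl 0 (fun _ => u) = Set.univ := by
      ext ω
      simp [cyl]
    rw [IsProbVec, ← measure_iUnion (fun u w huw => ?_) fun u => measurableSet_cyl _ _, hU,
      measure_univ]
    refine Set.disjoint_left.2 fun ω h1 h2 => huw ?_
    exact (h1 0 le_rfl).symm.trans (h2 0 le_rfl)
  · by_cases hu : ∃ n a, a n = u ∧ μ (cyl n a) ≠ 0
    · simp only [if_pos hu]
      obtain ⟨n, a, rfl, ha⟩ := hu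
      have h1 : ∀ w, μ (cyl (n + 1) (Function.update a (n + 1) w)) = μ (cyl n a) * p (a n) w := by
        intro w
        rw [hp, Function.update_self, Function.update_of_ne (by omega),
          cyl_congr fun i (hi : i ≤ n) => Function.update_of_ne (by omega : i ≠ n + 1) w a]
      have hU : ⋃ w : U, cyl (n + 1) (Function.update a (n + 1) w) = cyl n a := by
        ext ω
        simp only [Set.mem_iUnion, cyl, Set.mem_ofPred_eq]
        constructor
        · rintro ⟨w, hw⟩ i hi
          rw [hw i (by omega), Function.update_of_ne (by omega)]
        · intro h
          refine ⟨ω (n + 1), fun i hi => ?_⟩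
          rcases hi.lt_or_eq with hi | rfl
          · rw [Function.update_of_ne hi.ne, h i (by omega)]
          · simp
      have h2 : ∑' w, μ (cyl n a) * p (a n) w = μ (cyl n a) := by
        simp_rw [← h1]
        rw [← measure_iUnion (fun u w huw => ?_) fun u => measurableSet_cyl _ _, hU]
        refine Set.disjoint_left.2 fun ω h1 h2 => huw ?_
        simpa using (h1 (n + 1) le_rfl).symm.trans (h2 (n + 1) le_rfl)
      rw [ENNReal.tsum_mul_left] at h2
      exact (ENNReal.mul_right_inj ha (measure_ne_top _ _)).1 (by rw [h2, mul_one])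
    · simp only [if_neg hu]
      exact tsum_ite_eq u _
  · change μ (cyl n a) = _
    induction n with
    | zero => simp [cyl]
    | succ n ih =>
      rw [Finset.prod_range_succ, ← mul_assoc, ← ih, hp]
      by_cases h : μ (cyl n a) = 0
      · simp [h]
      · have : ∃ m b, b m = a n ∧ μ (cyl m b) ≠ 0 := ⟨n, a, rfl, h⟩
        simp only [if_pos this]

end Markov

section ConditionalCoupling

variable {E₁ E₂ G : Type*} [MeasurableSpace E₁] [MeasurableSpace E₂] [MeasurableSpace G]

/-- Disintegration of a law along the map `F`. -/
lemma exists_disintegration [StandardBorelSpace E₁] (μ : Measure E₁) [IsProbabilityMeasure μ]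
    (F : E₁ → G) :
    ∃ κ : Kernel G E₁, IsMarkovKernel κ ∧
      μ.map F ⊗ₘ κ = μ.map (fun x => (F x, x)) := by
  have : Nonempty E₁ := μ.nonempty_of_neZero
  exact ⟨condDistrib id F μ, inferInstance, compProd_map_condDistrib aemeasurable_id⟩

/-- Two laws with a common image have a coupling over that image for which the two coordinates
are conditionally independent given the image. -/
lemma exists_coupling [StandardBorelSpace E₁] [StandardBorelSpace E₂] [MeasurableEq G]
    (μ₁ : Measure E₁) (μ₂ : Measure E₂) [IsProbabilityMeasure μ₁] [IsProbabilityMeasure μ₂]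
    {F₁ : E₁ → G} {F₂ : E₂ → G} (hF₁ : Measurable F₁) (hF₂ : Measurable F₂) {ν : Measure G}
    (h₁ : μ₁.map F₁ = ν) (h₂ : μ₂.map F₂ = ν) :
    ∃ (ρ : Measure (E₁ × E₂)) (κ₁ : Kernel G E₁) (κ₂ : Kernel G E₂),
      IsMarkovKernel κ₁ ∧ IsMarkovKernel κ₂ ∧
      (∀ D S, MeasurableSet D → MeasurableSet S →
        ∫⁻ z in D, κ₁ z S ∂ν = μ₁ (F₁ ⁻¹' D ∩ S)) ∧
      (∀ D S, MeasurableSet D → MeasurableSet S →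
        ∫⁻ z in D, κ₂ z S ∂ν = μ₂ (F₂ ⁻¹' D ∩ S)) ∧
      (∀ D S T, MeasurableSet D → MeasurableSet S → MeasurableSet T →
        ρ {p | F₁ p.1 ∈ D ∧ p.1 ∈ S ∧ p.2 ∈ T} = ∫⁻ z in D, κ₁ z S * κ₂ z T ∂ν) ∧
      ∀ᵐ p ∂ρ, F₁ p.1 = F₂ p.2 := by
  obtain ⟨κ₁, hκ₁, hc₁⟩ := exists_disintegration μ₁ F₁
  obtain ⟨κ₂, hκ₂, hc₂⟩ := exists_disintegration μ₂ F₂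
  rw [h₁] at hc₁
  rw [h₂] at hc₂
  have : IsProbabilityMeasure ν := h₁ ▸ Measure.isProbabilityMeasure_map hF₁.aemeasurable
  set τ : Measure (G × E₁ × E₂) := ν ⊗ₘ (κ₁ ×ₖ κ₂) with hτ
  have hg₁ : ∀ᵐ q ∂(ν ⊗ₘ κ₁), F₁ q.2 = q.1 := by
    rw [hc₁, ae_map_iff (by fun_prop) (measurableSet_eq_fun (by fun_prop) (by fun_prop))]
    exact ae_of_all _ fun _ => rfl
  have hg₂ : ∀ᵐ q ∂(ν ⊗ₘ κ₂), F₂ q.2 = q.1 := by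
    rw [hc₂, ae_map_iff (by fun_prop) (measurableSet_eq_fun (by fun_prop) (by fun_prop))]
    exact ae_of_all _ fun _ => rfl
  have hτ₁ : τ.map (fun q => (q.1, q.2.1)) = ν ⊗ₘ κ₁ := by
    refine Measure.ext_prod fun {D S} hD hS => ?_
    rw [Measure.map_apply (by fun_prop) (hD.prod hS), Measure.compProd_apply_prod hD hS]
    have : (fun q : G × E₁ × E₂ => (q.1, q.2.1)) ⁻¹' (D ×ˢ S) = D ×ˢ (S ×ˢ Set.univ) := by
      ext; simp
    rw [this, hτ, Measure.compProd_apply_prod hD (hS.prod .univ)]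
    simp [Kernel.prod_apply_prod]
  have hτ₂ : τ.map (fun q => (q.1, q.2.2)) = ν ⊗ₘ κ₂ := by
    refine Measure.ext_prod fun {D S} hD hS => ?_
    rw [Measure.map_apply (by fun_prop) (hD.prod hS), Measure.compProd_apply_prod hD hS]
    have : (fun q : G × E₁ × E₂ => (q.1, q.2.2)) ⁻¹' (D ×ˢ S) = D ×ˢ (Set.univ ×ˢ S) := by
      ext; simp
    rw [this, hτ, Measure.compProd_apply_prod hD (MeasurableSet.univ.prod hS)]
    simp [Kernel.prod_apply_prod]
  rw [← hτ₁] at hg₁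
  rw [← hτ₂] at hg₂
  replace hg₁ := ae_of_ae_map (by fun_prop) hg₁
  replace hg₂ := ae_of_ae_map (by fun_prop) hg₂
  refine ⟨τ.map Prod.snd, κ₁, κ₂, hκ₁, hκ₂, fun D S hD hS => ?_, fun D S hD hS => ?_,
    fun D S T hD hS hT => ?_, ?_⟩
  · rw [← Measure.compProd_apply_prod hD hS, hc₁, Measure.map_apply (by fun_prop) (hD.prod hS)]
    rfl
  · rw [← Measure.compProd_apply_prod hD hS, hc₂, Measure.map_apply (by fun_prop) (hD.prod hS)]
    rfl
  · have hm : MeasurableSet {p : E₁ × E₂ | F₁ p.1 ∈ D ∧ p.1 ∈ S ∧ p.2 ∈ T} :=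
      ((hF₁.comp measurable_fst) hD).inter ((measurable_fst hS).inter (measurable_snd hT))
    rw [Measure.map_apply measurable_snd hm]
    simp_rw [← Kernel.prod_apply_prod]
    rw [← Measure.compProd_apply_prod hD (hS.prod hT)]
    refine measure_congr ?_
    filter_upwards [hg₁] with q hq
    refine propext ?_
    change (F₁ q.2.1 ∈ D ∧ q.2.1 ∈ S ∧ q.2.2 ∈ T) ↔ (q.1 ∈ D ∧ q.2.1 ∈ S ∧ q.2.2 ∈ T)
    rw [show F₁ q.2.1 = q.1 from hq]
  · rw [ae_map_iff (by fun_prop) (measurableSet_eq_fun (by fun_prop) (by fun_prop))]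
    filter_upwards [hg₁, hg₂] with q hq₁ hq₂
    exact hq₁.trans hq₂.symm

lemma condExp_indic {Ω : Type*} [MeasurableSpace Ω] {μ : Measure Ω} [IsProbabilityMeasure μ]
    {Z : Ω → G} (hZ : Measurable Z) {s : Set Ω} (hs : MeasurableSet s) {φ : G → ℝ≥0∞}
    (hφ : Measurable φ) (hφ1 : ∀ z, φ z ≤ 1)
    (h : ∀ D, MeasurableSet D → μ (Z ⁻¹' D ∩ s) = ∫⁻ z in D, φ z ∂(μ.map Z)) :
    μ[indic s|MeasurableSpace.comap Z inferInstance] =ᵐ[μ] fun ω => (φ (Z ω)).toReal := by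
  have hm := hZ.comap_le
  have hint : Integrable (fun ω => (φ (Z ω)).toReal) μ := by
    refine Integrable.of_bound (C := 1)
      (hφ.comp hZ).ennreal_toReal.aestronglyMeasurable (ae_of_all _ fun ω => ?_)
    rw [Real.norm_of_nonneg ENNReal.toReal_nonneg]
    exact ENNReal.toReal_le_of_le_ofReal zero_le_one (by simpa using hφ1 _)
  refine (ae_eq_condExp_of_forall_setIntegral_eq hm ?_ (fun _ _ _ => hint.integrableOn) ?_
    ?_).symm
  · exact (integrable_const (1 : ℝ)).indicator hs
  · rintro _ ⟨D, hD, rfl⟩ -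
    rw [integral_toReal (by fun_prop) (ae_of_all _ fun ω => (hφ1 _).trans_lt ENNReal.one_lt_top),
      ← setLIntegral_map hD hφ hZ, ← h D hD, indic, setIntegral_indicator hs]
    simp [Measure.real]
  · exact ((hφ.ennreal_toReal).comp (comap_measurable Z)).aestronglyMeasurable

/-- Conditional independence from a factorised conditional law. -/
lemma condIndepGiven_of_kernel {Ω : Type*} [MeasurableSpace Ω] {μ : Measure Ω}
    [IsProbabilityMeasure μ] {Z : Ω → G} {X : Ω → E₁} {Y : Ω → E₂} (hZ : Measurable Z)
    (hX : Measurable X) (hY : Measurable Y) (κ₁ : Kernel G E₁) (κ₂ : Kernel G E₂)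
    [IsMarkovKernel κ₁] [IsMarkovKernel κ₂]
    (h : ∀ D S T, MeasurableSet D → MeasurableSet S → MeasurableSet T →
      μ (Z ⁻¹' D ∩ (X ⁻¹' S ∩ Y ⁻¹' T)) = ∫⁻ z in D, κ₁ z S * κ₂ z T ∂(μ.map Z)) :
    CondIndepGiven μ Z X Y := by
  rintro _ _ ⟨S, hS, rfl⟩ ⟨T, hT, rfl⟩
  have e₁ := condExp_indic (μ := μ) hZ (hX hS) (Kernel.measurable_coe κ₁ hS)
    (fun _ => prob_le_one) (fun D hD => by simpa using h D S .univ hD hS .univ)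
  have e₂ := condExp_indic (μ := μ) hZ (hY hT) (Kernel.measurable_coe κ₂ hT)
    (fun _ => prob_le_one) (fun D hD => by simpa using h D .univ T hD .univ hT)
  have e₃ := condExp_indic (μ := μ) hZ ((hX hS).inter (hY hT))
    ((Kernel.measurable_coe κ₁ hS).mul (Kernel.measurable_coe κ₂ hT))
    (fun _ => mul_le_one' prob_le_one prob_le_one) (fun D hD => h D S T hD hS hT)
  filter_upwards [e₁, e₂, e₃] with ω h1 h2 h3
  rw [h3, Pi.mul_apply, Pi.mul_apply, h1, h2, ENNReal.toReal_mul]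

end ConditionalCoupling

section Image

variable {A C : Type*} [Countable A] [MeasurableSpace A] [MeasurableSpace C]
  [MeasurableSingletonClass A]

lemma measurable_comp_path (f : A → C) : Measurable fun (ω : ℕ → A) n => f (ω n) :=
  measurable_pi_lambda _ fun n => (measurable_of_countable f).comp (measurable_pi_apply n)

/-- Given a path `a` up to time `n`, the law of the image process has a density with respect to
the image chain, and this density is a time-independent function of the current state and the
future of the image. -/
lemma exists_density [MeasurableSingletonClass C] {v : A → ℝ≥0∞} {P : A → A → ℝ≥0∞} {μ : Measure (ℕ → A)}
    (hμ : IsMarkovChain v P μ) (f : A → C) {ν : Measure (ℕ → C)}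
    (hf : μ.map (fun ω n => f (ω n)) = ν) {L : C → Measure (ℕ → C)}
    [∀ c, IsFiniteMeasure (L c)]
    (hL : ∀ n c, (ν.restrict (cyl n c)).map (shift n) = ν (cyl n c) • L (c n)) :
    ∃ h : A → (ℕ → C) → ℝ≥0∞, (∀ a, Measurable (h a)) ∧ ∀ n a D, MeasurableSet D →
      μ ((fun ω n => f (ω n)) ⁻¹' D ∩ cyl n a) =
        ∫⁻ z in D, (cyl n (fun i => f (a i))).indicator
          (fun z => μ (cyl n a) / ν (cyl n (fun i => f (a i))) * h (a n) (shift n z)) z ∂ν := by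
  have := hμ.1
  set F : (ℕ → A) → ℕ → C := fun ω n => f (ω n) with hFdef
  have hF : Measurable F := measurable_comp_path f
  have : IsProbabilityMeasure ν := hf ▸ Measure.isProbabilityMeasure_map hF.aemeasurable
  obtain ⟨Q, hQfin, hQ⟩ := exists_future hμ
  have hQ' : ∀ n a D, MeasurableSet D →
      μ (cyl n a ∩ shift n ⁻¹' (F ⁻¹' D)) = μ (cyl n a) * (Q (a n)).map F D := by
    intro n a D hD
    have := congrArg (fun m => m (F ⁻¹' D)) (hQ n a)
    simp only [Measure.smul_apply, smul_eq_mul] at this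
    rw [Measure.map_apply (measurable_shift n) (hF hD),
      Measure.restrict_apply (measurable_shift n (hF hD))] at this
    rw [Set.inter_comm, this, Measure.map_apply hF hD]
  have hcyl : ∀ n a, cyl n a ⊆ F ⁻¹' cyl n (F a) := fun n a ω hω i hi => by
    simp [hFdef, hω i hi]
  have hle : ∀ n a D, MeasurableSet D →
      μ (cyl n a ∩ F ⁻¹' D) ≤ ν (cyl n (F a) ∩ D) := by
    intro n a D hD
    rw [← hf, Measure.map_apply hF ((measurableSet_cyl _ _).inter hD)]
    exact measure_mono (Set.inter_subset_inter_left _ (hcyl n a))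
  refine ⟨fun a => ((Q a).map F).rnDeriv (L (f a)), fun a => Measure.measurable_rnDeriv _ _,
    fun n a D hD => ?_⟩
  set k : (ℕ → C) → ℝ≥0∞ := ((Q (a n)).map F).rnDeriv (L (f (a n))) with hk
  change _ = ∫⁻ z in D, (cyl n (F a)).indicator
    (fun z => μ (cyl n a) / ν (cyl n (F a)) * k (shift n z)) z ∂ν
  have hkm : Measurable k := Measure.measurable_rnDeriv _ _
  by_cases h0 : μ (cyl n a) = 0
  · simp [h0, measure_mono_null Set.inter_subset_right h0]
  have hν0 : ν (cyl n (F a)) ≠ 0 := fun hz => h0 <| by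
    have := hle n a Set.univ .univ
    simpa [hz] using this
  have hac : (Q (a n)).map F ≪ L (f (a n)) := by
    refine Measure.AbsolutelyContinuous.mk fun D hD hD0 => ?_
    have h1 := congrArg (fun m => m D) (hL n (F a))
    simp only [Measure.smul_apply, smul_eq_mul] at h1
    rw [Measure.map_apply (measurable_shift n) hD,
      Measure.restrict_apply (measurable_shift n hD), Set.inter_comm] at h1
    have h2 := hle n a _ (measurable_shift n hD)
    rw [h1, show L (F a n) D = 0 from hD0, mul_zero] at h2
    have h3 := hQ' n a D hD
    rw [show shift n ⁻¹' (F ⁻¹' D) = F ⁻¹' (shift n ⁻¹' D) from rfl,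
      nonpos_iff_eq_zero.1 h2] at h3
    exact (mul_eq_zero.1 h3.symm).resolve_left h0
  set D' : Set (ℕ → C) := glue n (F a) ⁻¹' D with hD'
  have hD'm : MeasurableSet D' := measurable_glue n _ hD
  have hDD' : ∀ z ∈ cyl n (F a), (z ∈ D ↔ shift n z ∈ D') := fun z hz => by
    rw [hD', Set.mem_preimage, glue_shift hz]
  have e1 : F ⁻¹' D ∩ cyl n a = cyl n a ∩ shift n ⁻¹' (F ⁻¹' D') := by
    ext ω
    constructor
    · rintro ⟨h1, h2⟩
      exact ⟨h2, (hDD' _ (hcyl n a h2)).1 h1⟩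
    · rintro ⟨h1, h2⟩
      exact ⟨(hDD' _ (hcyl n a h1)).2 h2, h1⟩
  have e2 : cyl n (F a) ∩ D = shift n ⁻¹' D' ∩ cyl n (F a) := by
    ext z
    constructor
    · rintro ⟨h1, h2⟩
      exact ⟨(hDD' _ h1).1 h2, h1⟩
    · rintro ⟨h1, h2⟩
      exact ⟨h2, (hDD' _ h2).2 h1⟩
  rw [e1, hQ' n a D' hD'm, ← Measure.withDensity_rnDeriv_eq _ _ hac, ← hk,
    withDensity_apply _ hD'm, lintegral_indicator (measurableSet_cyl _ _),
    Measure.restrict_restrict (measurableSet_cyl _ _), e2,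
    ← Measure.restrict_restrict (measurable_shift n hD'm),
    lintegral_const_mul (f := fun z => k (shift n z)) _ (hkm.comp (measurable_shift n)),
    ← setLIntegral_map hD'm hkm (measurable_shift n), hL, Measure.restrict_smul,
    lintegral_smul_measure, smul_eq_mul, ← mul_assoc,
    ENNReal.div_mul_cancel hν0 (measure_ne_top _ _)]

end Image

end MarkovCoupling

open MarkovCoupling

/-- **Homogeneous coupling.** If Markov chains `X̄`, `Ȳ` have a common image Markov chain
`Z̄` under maps `f`, `g`, then there is a homogeneous Markov coupling `W = (X,Y)` with
`f(X_t) = g(Y_t)` for all `t`, whose marginals are `X̄` and `Ȳ` and which may be chosen so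
that `X` and `Y` are conditionally independent given the process `(f(X_t))_t`. -/
theorem statement_0
    {A B C : Type*} [Countable A] [Countable B] [Countable C]
    [MeasurableSpace A] [MeasurableSingletonClass A]
    [MeasurableSpace B] [MeasurableSingletonClass B]
    [MeasurableSpace C] [MeasurableSingletonClass C]
    (αX : A → ℝ≥0∞) (PX : A → A → ℝ≥0∞) (μX : Measure (ℕ → A))
    (αY : B → ℝ≥0∞) (PY : B → B → ℝ≥0∞) (μY : Measure (ℕ → B))
    (αZ : C → ℝ≥0∞) (PZ : C → C → ℝ≥0∞) (μZ : Measure (ℕ → C))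
    (f : A → C) (g : B → C)
    (hX : IsMarkovChain αX PX μX) (hY : IsMarkovChain αY PY μY)
    (hZ : IsMarkovChain αZ PZ μZ)
    (hfX : μX.map (fun ω n => f (ω n)) = μZ)
    (hgY : μY.map (fun ω n => g (ω n)) = μZ) :
    ∃ (αW : A × B → ℝ≥0∞) (PW : A × B → A × B → ℝ≥0∞) (μW : Measure (ℕ → A × B)),
      IsMarkovChain αW PW μW ∧
      μW.map (fun ω n => (ω n).1) = μX ∧
      μW.map (fun ω n => (ω n).2) = μY ∧
      (∀ᵐ ω ∂μW, ∀ t : ℕ, f (ω t).1 = g (ω t).2) ∧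
      CondIndepGiven μW (fun ω n => f (ω n).1) (fun ω n => (ω n).1) (fun ω n => (ω n).2) := by
  have := hX.1
  have := hY.1
  set F : (ℕ → A) → ℕ → C := fun ω n => f (ω n)
  set K : (ℕ → B) → ℕ → C := fun ω n => g (ω n)
  have hFm : Measurable F := measurable_comp_path f
  have hKm : Measurable K := measurable_comp_path g
  obtain ⟨ρ, κ₁, κ₂, hκ₁, hκ₂, hd₁, hd₂, hρ, hρfg⟩ :=
    exists_coupling μX μY hFm hKm hfX hgY
  have := hZ.1
  have hρ' : ∀ S T, MeasurableSet S → MeasurableSet T →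
      ρ (S ×ˢ T) = ∫⁻ z, κ₁ z S * κ₂ z T ∂μZ := by
    intro S T hS hT
    have := hρ .univ S T .univ hS hT
    simp only [Set.mem_univ, true_and, Measure.restrict_univ] at this
    exact this
  have hρ₁ : ρ.map Prod.fst = μX := by
    ext S hS
    have h1 := hρ' S .univ hS .univ
    have h2 := hd₁ .univ S .univ hS
    rw [Measure.map_apply measurable_fst hS, ← Set.prod_univ, h1]
    simpa using h2
  have hρ₂ : ρ.map Prod.snd = μY := by
    ext T hT
    have h1 := hρ' .univ T .univ hT
    have h2 := hd₂ .univ T .univ hT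
    rw [Measure.map_apply measurable_snd hT, ← Set.univ_prod, h1]
    simpa using h2
  have hρp : IsProbabilityMeasure ρ := ⟨by
    rw [← Set.univ_prod_univ, hρ' _ _ .univ .univ]; simp⟩
  set zip : (ℕ → A) × (ℕ → B) → ℕ → A × B := fun p n => (p.1 n, p.2 n) with hzip
  have hzm : Measurable zip := by fun_prop
  have hWp : IsProbabilityMeasure (ρ.map zip) := Measure.isProbabilityMeasure_map hzm.aemeasurable
  have hfst : Measurable fun (ω : ℕ → A × B) n => (ω n).1 := by fun_prop
  have hsnd : Measurable fun (ω : ℕ → A × B) n => (ω n).2 := by fun_prop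
  have hfstf : Measurable fun (ω : ℕ → A × B) n => f (ω n).1 := hFm.comp hfst
  have hWZ : (ρ.map zip).map (fun ω n => f (ω n).1) = μZ := by
    rw [Measure.map_map hfstf hzm, ← hfX, ← hρ₁, Measure.map_map hFm measurable_fst]
    rfl
  obtain ⟨L, hLfin, hL⟩ := exists_future hZ
  obtain ⟨h, hhm, hh⟩ := exists_density hX f hfX hL
  obtain ⟨k, hkm, hk⟩ := exists_density hY g hgY hL
  have hκh : ∀ n a, (fun z => κ₁ z (cyl n a)) =ᵐ[μZ] (cyl n (F a)).indicator
      (fun z => μX (cyl n a) / μZ (cyl n (F a)) * h (a n) (shift n z)) := fun n a =>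
    ae_eq_of_forall_setLIntegral_eq_of_sigmaFinite
      (κ₁.measurable_coe (measurableSet_cyl n a))
      ((((hhm _).comp (measurable_shift n)).const_mul _).indicator (measurableSet_cyl _ _))
      fun D hD _ => (hd₁ D _ hD (measurableSet_cyl n a)).trans (hh n a D hD)
  have hκk : ∀ n b, (fun z => κ₂ z (cyl n b)) =ᵐ[μZ] (cyl n (K b)).indicator
      (fun z => μY (cyl n b) / μZ (cyl n (K b)) * k (b n) (shift n z)) := fun n b =>
    ae_eq_of_forall_setLIntegral_eq_of_sigmaFinite
      (κ₂.measurable_coe (measurableSet_cyl n b))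
      ((((hkm _).comp (measurable_shift n)).const_mul _).indicator (measurableSet_cyl _ _))
      fun D hD _ => (hd₂ D _ hD (measurableSet_cyl n b)).trans (hk n b D hD)
  let H : A × B → ℝ≥0∞ := fun w => ∫⁻ z, h w.1 z * k w.2 z ∂(L (f w.1))
  let M : ℕ → (ℕ → A × B) → ℝ≥0∞ := fun n w =>
    if ∀ i ≤ n, f (w i).1 = g (w i).2 then
      μX (cyl n fun i => (w i).1) / μZ (cyl n fun i => f (w i).1)
        * (μY (cyl n fun i => (w i).2) / μZ (cyl n fun i => f (w i).1))
        * μZ (cyl n fun i => f (w i).1)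
    else 0
  let q : A × B → A × B → ℝ≥0∞ := fun w w' =>
    if f w'.1 = g w'.2 then
      PX w.1 w'.1 / PZ (f w.1) (f w'.1) * (PY w.2 w'.2 / PZ (f w.1) (f w'.1))
        * PZ (f w.1) (f w'.1)
    else 0
  have hcylW : ∀ n w, ρ.map zip (cyl n w) = M n w * H (w n) := by
    intro n w
    rw [Measure.map_apply hzm (measurableSet_cyl n w)]
    have hpre : zip ⁻¹' cyl n w = (cyl n fun i => (w i).1) ×ˢ (cyl n fun i => (w i).2) := by
      ext p
      simp only [hzip, cyl, Set.mem_preimage, Set.mem_ofPred_eq, Set.mem_prod, Prod.ext_iff]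
      exact forall₂_and
    rw [hpre, hρ' _ _ (measurableSet_cyl _ _) (measurableSet_cyl _ _)]
    refine (lintegral_congr_ae ((hκh n _).mul (hκk n _))).trans ?_
    by_cases hw : ∀ i ≤ n, f (w i).1 = g (w i).2
    · have hc : cyl n (K fun i => (w i).2) = cyl n (F fun i => (w i).1) :=
        cyl_congr fun i hi => (hw i hi).symm
      have hLn := hL n (F fun i => (w i).1)
      have hHm : Measurable fun z => h (w n).1 z * k (w n).2 z := (hhm _).mul (hkm _)
      simp only [M, if_pos hw]
      rw [hc]
      calc _ = ∫⁻ z, (cyl n (F fun i => (w i).1)).indicator (fun z =>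
              μX (cyl n fun i => (w i).1) / μZ (cyl n (F fun i => (w i).1))
              * (μY (cyl n fun i => (w i).2) / μZ (cyl n (F fun i => (w i).1)))
              * (h (w n).1 (shift n z) * k (w n).2 (shift n z))) z ∂μZ := by
            refine lintegral_congr fun z => ?_
            by_cases hz : z ∈ cyl n (F fun i => (w i).1)
            · simp only [Pi.mul_apply, Set.indicator_of_mem hz]
              ring
            · simp [Set.indicator_of_notMem hz]
        _ = _ := by
            rw [lintegral_indicator (measurableSet_cyl _ _),
              lintegral_const_mul (f := fun z => h (w n).1 (shift n z) * k (w n).2 (shift n z)) _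
                (hHm.comp (measurable_shift n)),
              ← lintegral_map hHm (measurable_shift n), hLn, lintegral_smul_measure, smul_eq_mul,
              ← mul_assoc]
    · simp only [M, if_neg hw, zero_mul]
      refine (lintegral_congr fun z => ?_).trans lintegral_zero
      by_contra hne
      rw [Pi.mul_apply] at hne
      have h1 := Set.mem_of_indicator_ne_zero (left_ne_zero_of_mul hne)
      have h2 := Set.mem_of_indicator_ne_zero (right_ne_zero_of_mul hne)
      exact hw fun i hi => (h1 i hi).symm.trans (h2 i hi)
  have hMq : ∀ n w, M (n + 1) w = M n w * q (w n) (w (n + 1)) := by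
    intro n w
    have hiff : (∀ i ≤ n + 1, f (w i).1 = g (w i).2) ↔
        (∀ i ≤ n, f (w i).1 = g (w i).2) ∧ f (w (n + 1)).1 = g (w (n + 1)).2 :=
      ⟨fun H => ⟨fun i hi => H i (by omega), H _ le_rfl⟩, fun H i hi => by
        rcases hi.lt_or_eq with hi | rfl
        · exact H.1 i (by omega)
        · exact H.2⟩
    by_cases h1 : ∀ i ≤ n, f (w i).1 = g (w i).2
    · by_cases h2 : f (w (n + 1)).1 = g (w (n + 1)).2
      · simp only [M, q, if_pos h1, if_pos h2, if_pos (hiff.2 ⟨h1, h2⟩)]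
        rw [measure_cyl_succ hX, measure_cyl_succ hY, measure_cyl_succ hZ]
        simp only [div_eq_mul_inv]
        rw [ENNReal.mul_inv (.inr (transition_ne_top hZ _ _)) (.inl (measure_ne_top _ _))]
        ring
      · simp only [M, q, if_neg h2, if_neg (mt hiff.1 fun h => h2 h.2), mul_zero]
    · simp only [M, if_neg h1, if_neg (mt hiff.1 fun h => h1 h.1), zero_mul]
  obtain ⟨αW, PW, hW⟩ := exists_isMarkovChain (μ := ρ.map zip)
    (fun w w' => q w w' * H w' / H w) fun n w => by
      have hle := measure_mono (μ := ρ.map zip) (cyl_succ_subset n w)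
      have hfin := measure_ne_top (ρ.map zip) (cyl n w)
      rw [hcylW, hcylW, hMq] at hle
      rw [hcylW] at hfin
      rw [hcylW, hcylW, hMq]
      by_cases h0 : H (w n) = 0
      · rw [h0, mul_zero, nonpos_iff_eq_zero] at hle
        rw [hle, h0, mul_zero, zero_mul]
      by_cases htop : H (w n) = ∞
      · have : M n w = 0 := by
          by_contra hM
          exact hfin (by rw [htop, ENNReal.mul_top hM])
        simp [this]
      · rw [mul_assoc (M n w) (H (w n)), ENNReal.mul_div_cancel h0 htop, mul_assoc]
  refine ⟨αW, PW, ρ.map zip, hW, ?_, ?_, ?_, ?_⟩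
  · rw [Measure.map_map hfst hzm, ← hρ₁]
    rfl
  · rw [Measure.map_map hsnd hzm, ← hρ₂]
    rfl
  · have hms : MeasurableSet {ω : ℕ → A × B | ∀ t, f (ω t).1 = g (ω t).2} :=
      MeasurableSet.congr (MeasurableSet.iInter fun t =>
        measurable_pi_apply t (Set.to_countable {w : A × B | f w.1 = g w.2}).measurableSet)
        (by ext; simp)
    rw [ae_map_iff hzm.aemeasurable hms]
    filter_upwards [hρfg] with p hp t
    exact congrFun hp t
  · refine condIndepGiven_of_kernel hfstf hfst hsnd κ₁ κ₂ fun D S T hD hS hT => ?_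
    rw [hWZ, ← hρ D S T hD hS hT,
      Measure.map_apply hzm ((hfstf hD).inter ((hfst hS).inter (hsnd hT)))]
    rfl
end

section
/- Let X̄, Ȳ, Z̄ be (possibly time-inhomogeneous) Markov chains with time indexed by ℕ and countable state spaces A, B, C respectively, and let f: A → C and g: B → C be maps such that f(X̄) =ᵈ Z̄ =ᵈ g(Ȳ). Then there exists a (possibly time-inhomogeneous) Markov chain (X_t, Y_t)_{t≥0} taking values in A×B such that (X_t)_{t≥0} =ᵈ X̄, (Y_t)_{t≥0} =ᵈ Ȳ, almost surely f(X_t) = g(Y_t) for all t ≥ 0, and X and Y may be taken conditionally independent given the process (f(X_t))_{t≥0}. -/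
open MeasureTheory Filter Topology
open scoped ENNReal Classical

/-- `μ` is the law on path space of the (possibly time-inhomogeneous) Markov chain
`MC(v,(P_t)_{t≥1})`: its cylinder probabilities are given by the initial distribution and
the successive transition matrices `P 1, P 2, …`. -/
def IsInhomMarkovChain {U : Type*} [MeasurableSpace U]
    (v : U → ℝ≥0∞) (P : ℕ → U → U → ℝ≥0∞) (μ : Measure (ℕ → U)) : Prop :=
  IsProbabilityMeasure μ ∧ IsProbVec v ∧ (∀ t, IsStochastic (P t)) ∧
    ∀ (k : ℕ) (a : ℕ → U),
      μ {ω | ∀ i ≤ k, ω i = a i} = v (a 0) * ∏ i ∈ Finset.range k, P (i + 1) (a i) (a (i + 1))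

open ProbabilityTheory

/-- The cylinder of paths which agree with `a` up to time `k`. -/
def pathCyl {U : Type*} (k : ℕ) (a : ℕ → U) : Set (ℕ → U) := {ω | ∀ i ≤ k, ω i = a i}

section Cylinder

variable {U : Type*} [MeasurableSpace U] [MeasurableSingletonClass U]

lemma measurableSet_pathCyl (k : ℕ) (a : ℕ → U) : MeasurableSet (pathCyl k a) := by
  have : pathCyl k a = ⋂ i ∈ Set.Iic k, (fun ω : ℕ → U => ω i) ⁻¹' {a i} := by
    ext ω; simp [pathCyl]
  rw [this]
  exact MeasurableSet.biInter (Set.to_countable _)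
    fun i _ => measurable_pi_apply i (measurableSet_singleton _)

lemma ext_of_pathCyl [Countable U] {μ ν : Measure (ℕ → U)} [IsFiniteMeasure μ]
    [IsFiniteMeasure ν] (h : ∀ k a, μ (pathCyl k a) = ν (pathCyl k a)) : μ = ν := by
  by_cases hU : Nonempty U
  swap
  · have : IsEmpty (ℕ → U) := ⟨fun ω => hU ⟨ω 0⟩⟩
    exact Subsingleton.elim _ _
  obtain ⟨u₀⟩ := hU
  have hfam : IsProjectiveMeasureFamily (α := fun _ : ℕ => U)
      (fun I : Finset ℕ => ν.map (I.restrict (π := fun _ : ℕ => U))) := by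
    intro I J hJI
    rw [Measure.map_map (by fun_prop) (by fun_prop)]
    rfl
  have hν : IsProjectiveLimit ν
      (fun I : Finset ℕ => ν.map (I.restrict (π := fun _ : ℕ => U))) := fun I => rfl
  refine IsProjectiveLimit.unique ((isProjectiveLimit_nat_iff hfam μ).2 fun n => ?_) hν
  refine Measure.ext_of_singleton fun b => ?_
  have hpre : (Preorder.frestrictLe (π := fun _ : ℕ => U) n) ⁻¹' {b}
      = pathCyl n (fun i => if hi : i ≤ n then b ⟨i, Finset.mem_Iic.2 hi⟩ else u₀) := by
    ext ω
    simp only [Set.mem_preimage, Set.mem_singleton_iff, pathCyl, Set.mem_ofPred_eq, funext_iff,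
      Subtype.forall, Finset.mem_Iic, Preorder.frestrictLe_apply]
    refine forall₂_congr fun i hi => ?_
    simp [hi]
  have hpre' : ((Finset.Iic n).restrict (π := fun _ : ℕ => U)) ⁻¹' {b} =
      (Preorder.frestrictLe (π := fun _ : ℕ => U) n) ⁻¹' {b} := rfl
  rw [Measure.map_apply (by fun_prop) (measurableSet_singleton b),
    Measure.map_apply (by fun_prop) (measurableSet_singleton b), hpre', hpre, h]

end Cylinder

section Markov

variable {U : Type*} [MeasurableSpace U] {v : U → ℝ≥0∞} {P : ℕ → U → U → ℝ≥0∞}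
  {μ : Measure (ℕ → U)}

lemma IsInhomMarkovChain.measure_pathCyl (h : IsInhomMarkovChain v P μ) (k : ℕ) (a : ℕ → U) :
    μ (pathCyl k a) = v (a 0) * ∏ i ∈ Finset.range k, P (i + 1) (a i) (a (i + 1)) :=
  h.2.2.2 k a

lemma IsInhomMarkovChain.measure_pathCyl_succ (h : IsInhomMarkovChain v P μ) (k : ℕ)
    (a : ℕ → U) :
    μ (pathCyl (k + 1) a) = μ (pathCyl k a) * P (k + 1) (a k) (a (k + 1)) := by
  rw [h.measure_pathCyl, h.measure_pathCyl, Finset.prod_range_succ, mul_assoc]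

lemma IsInhomMarkovChain.apply_ne_top (h : IsInhomMarkovChain v P μ) (t : ℕ) (u w : U) :
    P t u w ≠ ∞ :=
  ((ENNReal.le_tsum w).trans_lt (by rw [h.2.2.1 t u]; exact ENNReal.one_lt_top)).ne

/-- The joint law of the past and of the shifted path factorizes given the present. -/
lemma IsInhomMarkovChain.restrict_shift_pathCyl [MeasurableSingletonClass U]
    (h : IsInhomMarkovChain v P μ) (k : ℕ)
    (x : ℕ → U) (m : ℕ) (a : ℕ → U) :
    (μ.restrict (pathCyl k x)).map (fun ω n => ω (k + n)) (pathCyl m a)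
      = μ (pathCyl k x) * (if a 0 = x k then
          ∏ i ∈ Finset.range m, P (k + i + 1) (a i) (a (i + 1)) else 0) := by
  have hθ : Measurable (fun (ω : ℕ → U) (n : ℕ) => ω (k + n)) := by fun_prop
  rw [Measure.map_apply hθ (measurableSet_pathCyl m a),
    Measure.restrict_apply (hθ (measurableSet_pathCyl m a))]
  split_ifs with h0
  · have hb : (fun (ω : ℕ → U) (n : ℕ) => ω (k + n)) ⁻¹' pathCyl m a ∩ pathCyl k x
        = pathCyl (k + m) (fun i => if i ≤ k then x i else a (i - k)) := by
      ext ω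
      simp only [pathCyl, Set.mem_inter_iff, Set.mem_preimage, Set.mem_ofPred_eq]
      constructor
      · rintro ⟨h1, h2⟩ i hi
        split_ifs with hik
        · exact h2 i hik
        · have := h1 (i - k) (by omega)
          rwa [show k + (i - k) = i by omega] at this
      · intro h1
        refine ⟨fun i hi => ?_, fun i hi => ?_⟩
        · have := h1 (k + i) (by omega)
          rw [this]
          rcases Nat.eq_zero_or_pos i with rfl | hi0
          · simp [h0]
          · rw [if_neg (by omega), Nat.add_sub_cancel_left]
        · have := h1 i (by omega)
          rwa [if_pos hi] at this
    rw [hb, h.measure_pathCyl, h.measure_pathCyl, Finset.prod_range_add, mul_assoc]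
    congr 1
    congr 1
    · refine Finset.prod_congr rfl fun i hi => ?_
      have := Finset.mem_range.1 hi
      rw [if_pos (by omega), if_pos (by omega)]
    · refine Finset.prod_congr rfl fun i _ => ?_
      rw [if_neg (show ¬ k + i + 1 ≤ k by omega), show k + i + 1 - k = i + 1 by omega]
      rcases Nat.eq_zero_or_pos i with rfl | hi0
      · simp [h0]
      · rw [if_neg (by omega), Nat.add_sub_cancel_left]
  · rw [mul_zero]
    convert measure_empty (μ := μ)
    rw [Set.eq_empty_iff_forall_notMem]
    rintro ω ⟨h1, h2⟩
    exact h0 ((h1 0 (Nat.zero_le m)).symm.trans (h2 k le_rfl))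

/-- Existence of a law of the chain restarted at time `k` in state `u`. -/
lemma IsInhomMarkovChain.exists_restart [Countable U] [MeasurableSingletonClass U]
    (h : IsInhomMarkovChain v P μ) (k : ℕ) (u : U) :
    ∃ ρ : Measure (ℕ → U), IsFiniteMeasure ρ ∧ ∀ x : ℕ → U, x k = u →
      (μ.restrict (pathCyl k x)).map (fun ω n => ω (k + n)) = μ (pathCyl k x) • ρ := by
  have := h.1
  by_cases hx : ∃ x : ℕ → U, x k = u ∧ μ (pathCyl k x) ≠ 0
  · obtain ⟨x', hx'u, hx'⟩ := hx
    have hfin : IsFiniteMeasure ((μ (pathCyl k x'))⁻¹ •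
        (μ.restrict (pathCyl k x')).map (fun ω n => ω (k + n))) :=
      Measure.smul_finite _ (ENNReal.inv_ne_top.2 hx')
    refine ⟨_, hfin, fun x hxu => ?_⟩
    have := Measure.smul_finite ((μ (pathCyl k x'))⁻¹ •
        (μ.restrict (pathCyl k x')).map (fun ω n => ω (k + n))) (measure_ne_top μ (pathCyl k x))
    refine ext_of_pathCyl fun m a => ?_
    rw [Measure.smul_apply, Measure.smul_apply, h.restrict_shift_pathCyl,
      h.restrict_shift_pathCyl, hxu, hx'u, smul_eq_mul, smul_eq_mul,
      ← mul_assoc (μ (pathCyl k x'))⁻¹, ENNReal.inv_mul_cancel hx' (measure_ne_top _ _), one_mul]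
  · push Not at hx
    refine ⟨0, inferInstance, fun x hxu => ?_⟩
    rw [hx x hxu, zero_smul, Measure.restrict_eq_zero.2 (hx x hxu), Measure.map_zero]

end Markov

/-- Paths whose cylinder probabilities factorize through the last transition form a Markov
chain. -/
lemma exists_isInhomMarkovChain {U : Type*} [Countable U] [MeasurableSpace U]
    [MeasurableSingletonClass U] (μ : Measure (ℕ → U)) [IsProbabilityMeasure μ]
    (h : ∀ k : ℕ, ∃ (c : (ℕ → U) → ℝ≥0∞) (G : U → U → ℝ≥0∞), ∀ ω u,
      μ (pathCyl (k + 1) (Function.update ω (k + 1) u)) = c ω * G (ω k) u) :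
    ∃ (v : U → ℝ≥0∞) (P : ℕ → U → U → ℝ≥0∞), IsInhomMarkovChain v P μ := by
  choose c G hG using h
  set v : U → ℝ≥0∞ := fun u => μ ((fun ω : ℕ → U => ω 0) ⁻¹' {u}) with hv
  have hv1 : ∑' u, v u = 1 := by
    rw [← measure_univ (μ := μ), ← Set.preimage_univ (f := fun ω : ℕ → U => ω 0),
      ← Set.biUnion_of_singleton Set.univ, Set.preimage_iUnion₂,
      measure_biUnion Set.countable_univ]
    · exact (tsum_univ v).symm
    · intro a _ b _ hab
      exact Disjoint.preimage _ (by simpa using hab)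
    · exact fun b _ => measurable_pi_apply 0 (measurableSet_singleton _)
  set S : ℕ → U → ℝ≥0∞ := fun k u => ∑' w, G k u w with hS
  set P : ℕ → U → U → ℝ≥0∞ := fun t u w =>
    if S (t - 1) u ≠ 0 ∧ S (t - 1) u ≠ ∞ then G (t - 1) u w / S (t - 1) u else v w with hP
  have hsum : ∀ k ω, μ (pathCyl k ω) = c k ω * S k (ω k) := by
    intro k ω
    have hcyl : pathCyl k ω = ⋃ u, pathCyl (k + 1) (Function.update ω (k + 1) u) := by
      ext ω'
      simp only [pathCyl, Set.mem_ofPred_eq, Set.mem_iUnion]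
      constructor
      · intro h1
        refine ⟨ω' (k + 1), fun i hi => ?_⟩
        rcases eq_or_ne i (k + 1) with rfl | hne
        · simp
        · rw [Function.update_of_ne hne, h1 i (by omega)]
      · rintro ⟨u, h1⟩ i hi
        rw [h1 i (by omega), Function.update_of_ne (by omega)]
    rw [hcyl, measure_iUnion]
    · simp_rw [hG, hS, ENNReal.tsum_mul_left]
    · intro a b hab
      refine Set.disjoint_left.2 fun ω' h1 h2 => hab ?_
      have e1 := h1 (k + 1) le_rfl
      have e2 := h2 (k + 1) le_rfl
      rw [Function.update_self] at e1 e2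
      exact e1.symm.trans e2
    · exact fun u => measurableSet_pathCyl _ _
  refine ⟨v, P, inferInstance, hv1, fun t u => ?_, fun k a => ?_⟩
  · simp only [hP]
    split_ifs with hs
    · simp_rw [div_eq_mul_inv, ENNReal.tsum_mul_right]
      exact ENNReal.mul_inv_cancel hs.1 hs.2
    · exact hv1
  · change μ (pathCyl k a) = _
    induction k with
    | zero => simp [hv, pathCyl, Set.preimage]
    | succ k ih =>
      rw [Finset.prod_range_succ, ← mul_assoc, ← ih]
      have e := hG k a (a (k + 1))
      rw [Function.update_eq_self] at e
      rw [e, hsum]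
      simp only [hP, Nat.add_sub_cancel]
      split_ifs with hs
      · rw [mul_assoc, ENNReal.mul_div_cancel hs.1 hs.2]
      · by_cases h0 : S k (a k) = 0
        · have : G k (a k) (a (k + 1)) = 0 := ENNReal.tsum_eq_zero.1 h0 _
          rw [h0, this]; simp
        · have htop : S k (a k) = ∞ := by
            by_contra hne; exact hs ⟨h0, hne⟩
          have hc : c k a = 0 := by
            by_contra hc
            have := hsum k a
            rw [htop, ENNReal.mul_top hc] at this
            exact measure_ne_top _ _ this
          rw [hc]; simp

/-- A conditionally independent triple, described through the conditional laws. -/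
lemma condIndepGiven_of_map_eq_compProd {Ω γ α β : Type*} [MeasurableSpace Ω]
    [StandardBorelSpace Ω] [MeasurableSpace γ] [MeasurableSpace α] [StandardBorelSpace α]
    [Nonempty α] [MeasurableSpace β] [StandardBorelSpace β] [Nonempty β]
    {μ : Measure Ω} [IsFiniteMeasure μ] {Z : Ω → γ} {X : Ω → α} {Y : Ω → β}
    (hZ : Measurable Z) (hX : Measurable X) (hY : Measurable Y)
    {κ : Kernel γ α} {η : Kernel γ β} [IsMarkovKernel κ] [IsMarkovKernel η]
    (h : μ.map (fun ω => (Z ω, X ω, Y ω)) = μ.map Z ⊗ₘ (κ ×ₖ η)) :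
    CondIndepGiven μ Z X Y := by
  have hκ : condDistrib X Z μ =ᵐ[μ.map Z] κ := by
    refine condDistrib_ae_eq_of_measure_eq_compProd Z hX.aemeasurable ?_
    have := congrArg (Measure.map (Prod.map id Prod.fst)) h
    rw [Measure.map_map (by fun_prop) (by fun_prop), ← Measure.compProd_map (by fun_prop),
      ← Kernel.fst_eq, Kernel.fst_prod] at this
    exact this
  have hη : condDistrib Y Z μ =ᵐ[μ.map Z] η := by
    refine condDistrib_ae_eq_of_measure_eq_compProd Z hY.aemeasurable ?_
    have := congrArg (Measure.map (Prod.map id Prod.snd)) h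
    rw [Measure.map_map (by fun_prop) (by fun_prop), ← Measure.compProd_map (by fun_prop),
      ← Kernel.snd_eq, Kernel.snd_prod] at this
    exact this
  have hind : CondIndepFun (MeasurableSpace.comap Z inferInstance) hZ.comap_le X Y μ := by
    rw [condIndepFun_iff_map_prod_eq_prod_condDistrib_prod_condDistrib hX hY hZ, h,
      ← Measure.compProd_eq_comp_prod]
    refine Measure.compProd_congr ?_
    filter_upwards [hκ, hη] with z h1 h2
    rw [Kernel.prod_apply, Kernel.prod_apply, h1, h2]
  exact (condIndepFun_iff _ hZ.comap_le X Y hX hY μ).1 hind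

section Fibre

variable {S V : Type*} [MeasurableSpace S] [StandardBorelSpace S] [Nonempty S]
  [MeasurableSpace V] {μ : Measure S} [IsFiniteMeasure μ] {F : S → V}

/-- The conditional law given `F` lives on the fibres of `F`. -/
lemma ae_condDistrib_id_fibre [MeasurableEq V] (hF : Measurable F) :
    ∀ᵐ p ∂(μ.map F ⊗ₘ condDistrib id F μ), F p.2 = p.1 := by
  rw [compProd_map_condDistrib aemeasurable_id, ae_map_iff (by fun_prop)]
  · simp
  · exact measurableSet_eq_fun (by fun_prop) (by fun_prop)

lemma setLIntegral_condDistrib_id (hF : Measurable F) {s : Set S} (hs : MeasurableSet s)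
    {t : Set V} (ht : MeasurableSet t) :
    ∫⁻ z in t, condDistrib id F μ z s ∂(μ.map F) = μ (F ⁻¹' t ∩ s) := by
  rw [setLIntegral_map ht (Kernel.measurable_coe _ hs) hF,
    setLIntegral_preimage_condDistrib hF aemeasurable_id hs ht, Set.preimage_id]

lemma map_snd_compProd_condDistrib_id (hF : Measurable F) :
    (μ.map F ⊗ₘ condDistrib id F μ).map Prod.snd = μ := by
  rw [compProd_map_condDistrib aemeasurable_id, Measure.map_map (by fun_prop) (by fun_prop)]
  exact Measure.map_id

end Fibre

/-- Conditional independent product of two laws with a common image. -/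
lemma exists_condIndep_coupling {S T V : Type*} [MeasurableSpace S] [StandardBorelSpace S]
    [Nonempty S] [MeasurableSpace T] [StandardBorelSpace T] [Nonempty T]
    [MeasurableSpace V] [MeasurableEq V]
    {μ : Measure S} {ν : Measure T} {ζ : Measure V} [IsProbabilityMeasure μ]
    [IsProbabilityMeasure ν] {F : S → V} {G : T → V} (hF : Measurable F) (hG : Measurable G)
    (hμ : μ.map F = ζ) (hν : ν.map G = ζ) :
    ∃ π : Measure (S × T), IsProbabilityMeasure π ∧ π.map Prod.fst = μ ∧ π.map Prod.snd = ν ∧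
      (∀ᵐ w ∂π, F w.1 = G w.2) ∧
      π.map (fun w => (F w.1, w.1, w.2)) =
        ζ ⊗ₘ (condDistrib id F μ ×ₖ condDistrib id G ν) := by
  set κ := condDistrib id F μ with hκ
  set η := condDistrib id G ν with hη
  have : IsProbabilityMeasure ζ := hμ ▸ Measure.isProbabilityMeasure_map hF.aemeasurable
  set ρ : Measure (V × S × T) := ζ ⊗ₘ (κ ×ₖ η) with hρ
  have hρ1 : ρ.map (Prod.map id Prod.fst) = ζ ⊗ₘ κ := by
    rw [hρ, ← Measure.compProd_map (by fun_prop), ← Kernel.fst_eq, Kernel.fst_prod]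
  have hρ2 : ρ.map (Prod.map id Prod.snd) = ζ ⊗ₘ η := by
    rw [hρ, ← Measure.compProd_map (by fun_prop), ← Kernel.snd_eq, Kernel.snd_prod]
  have hFz : ∀ᵐ p ∂ρ, F p.2.1 = p.1 := by
    have := ae_condDistrib_id_fibre (μ := μ) hF
    rw [hμ, ← hκ, ← hρ1] at this
    exact ae_of_ae_map (by fun_prop) this
  have hGz : ∀ᵐ p ∂ρ, G p.2.2 = p.1 := by
    have := ae_condDistrib_id_fibre (μ := ν) hG
    rw [hν, ← hη, ← hρ2] at this
    exact ae_of_ae_map (by fun_prop) this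
  refine ⟨ρ.map Prod.snd, Measure.isProbabilityMeasure_map (by fun_prop), ?_, ?_, ?_, ?_⟩
  · have := map_snd_compProd_condDistrib_id (μ := μ) hF
    rw [hμ, ← hκ, ← hρ1, Measure.map_map (by fun_prop) (by fun_prop)] at this
    rw [Measure.map_map (by fun_prop) (by fun_prop)]
    exact this
  · have := map_snd_compProd_condDistrib_id (μ := ν) hG
    rw [hν, ← hη, ← hρ2, Measure.map_map (by fun_prop) (by fun_prop)] at this
    rw [Measure.map_map (by fun_prop) (by fun_prop)]
    exact this
  · rw [ae_map_iff (by fun_prop)]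
    · filter_upwards [hFz, hGz] with p h1 h2 using h1.trans h2.symm
    · exact measurableSet_eq_fun (by fun_prop) (by fun_prop)
  · rw [Measure.map_map (by fun_prop) (by fun_prop)]
    conv_rhs => rw [← Measure.map_id (μ := ρ)]
    refine Measure.map_congr ?_
    filter_upwards [hFz] with p h1
    simp [h1]

/-- A density, read off from a parametrization `c` of `s` with inverse `θ`. -/
lemma comp_ae_eq_rnDeriv {E E' : Type*} [MeasurableSpace E] [MeasurableSpace E']
    {μ : Measure E} {R L : Measure E'} [IsFiniteMeasure R] [IsFiniteMeasure L] {s : Set E}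
    {θ : E → E'} {c : E' → E} {φ : E → ℝ≥0∞} {p q : ℝ≥0∞}
    (hs : MeasurableSet s) (hθ : Measurable θ) (hc : Measurable c) (hφ : Measurable φ)
    (hcθ : ∀ e ∈ s, c (θ e) = e) (hR : (μ.restrict s).map θ = p • R) (hp : p ≠ 0) (hp' : p ≠ ∞)
    (hq : q ≠ ∞) (hL : ∀ t, MeasurableSet t → ∫⁻ e in θ ⁻¹' t ∩ s, φ e ∂μ = q * L t) :
    (fun ζ => φ (c ζ)) =ᵐ[R] fun ζ => q / p * L.rnDeriv R ζ := by
  have hqp : q / p ≠ ∞ := ENNReal.div_ne_top hq hp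
  have key : R.withDensity (fun ζ => φ (c ζ)) = (q / p) • L := by
    ext t ht
    rw [withDensity_apply _ ht, Measure.smul_apply, smul_eq_mul, div_eq_mul_inv,
      mul_right_comm, ← hL t ht, ← div_eq_mul_inv, ENNReal.eq_div_iff hp hp']
    calc p * ∫⁻ ζ in t, φ (c ζ) ∂ R = ∫⁻ ζ in t, φ (c ζ) ∂((μ.restrict s).map θ) := by
          rw [hR, Measure.restrict_smul, lintegral_smul_measure, smul_eq_mul]
      _ = ∫⁻ e in θ ⁻¹' t ∩ s, φ (c (θ e)) ∂μ := by
          rw [setLIntegral_map (f := fun ζ => φ (c ζ)) ht (hφ.comp hc) hθ,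
            Measure.restrict_restrict (hθ ht)]
      _ = ∫⁻ e in θ ⁻¹' t ∩ s, φ e ∂μ :=
          setLIntegral_congr_fun ((hθ ht).inter hs) fun e he => by
            simp only [hcθ e he.2]
  have h1 := Measure.rnDeriv_withDensity R (hφ.comp hc)
  have h2 := Measure.rnDeriv_smul_left_of_ne_top L R hqp
  rw [← key] at h2
  filter_upwards [h1, h2] with ζ e1 e2
  exact e1.symm.trans e2

/-- The path which follows `z` before time `k` and the path `ζ` from then on. -/
def concatPath {U : Type*} (k : ℕ) (z ζ : ℕ → U) : ℕ → U :=
  fun i => if i < k then z i else ζ (i - k)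

lemma measurable_concatPath {U : Type*} [MeasurableSpace U] (k : ℕ) (z : ℕ → U) :
    Measurable (concatPath k z) := by
  refine measurable_pi_lambda _ fun i => ?_
  unfold concatPath
  split_ifs <;> fun_prop

lemma pathCyl_congr {U : Type*} {k : ℕ} {x y : ℕ → U} (h : ∀ i ≤ k, x i = y i) :
    pathCyl k x = pathCyl k y :=
  Set.ext fun ω => forall₂_congr fun i hi => by rw [h i hi]

lemma concatPath_shift {U : Type*} {k : ℕ} {z ω : ℕ → U} (hω : ω ∈ pathCyl k z) :
    concatPath k z (fun n => ω (k + n)) = ω := by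
  funext i
  unfold concatPath
  split_ifs with hi
  · exact (hω i hi.le).symm
  · exact congrArg ω (Nat.add_sub_cancel' (not_lt.1 hi))

lemma measurable_map_path {A C : Type*} [Countable A] [MeasurableSpace A]
    [MeasurableSingletonClass A] [MeasurableSpace C] {f : A → C} :
    Measurable (fun (ω : ℕ → A) n => f (ω n)) := by
  have : Measurable f := measurable_of_countable f
  fun_prop

section Image

variable {A C : Type*} [Countable A]
  [MeasurableSpace A] [MeasurableSingletonClass A]
  [MeasurableSpace C] [MeasurableSingletonClass C]
  {αX : A → ℝ≥0∞} {PX : ℕ → A → A → ℝ≥0∞} {μX : Measure (ℕ → A)}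
  {μZ : Measure (ℕ → C)} {f : A → C}

lemma measure_pathCyl_le_map (hfX : μX.map (fun ω n => f (ω n)) = μZ) (k : ℕ) (x : ℕ → A) :
    μX (pathCyl k x) ≤ μZ (pathCyl k fun n => f (x n)) := by
  rw [← hfX, Measure.map_apply measurable_map_path (measurableSet_pathCyl _ _)]
  exact measure_mono fun ω hω i hi => congrArg f (hω i hi)

variable [Nonempty (ℕ → A)]

/-- The conditional probability of a cylinder given the image path is supported by the image
cylinder. -/
lemma ae_condDistrib_pathCyl_eq_zero [IsFiniteMeasure μX]
    (hfX : μX.map (fun ω n => f (ω n)) = μZ) (k : ℕ) (x : ℕ → A) :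
    ∀ᵐ z ∂μZ, z ∉ pathCyl k (fun n => f (x n)) →
      condDistrib id (fun (ω : ℕ → A) n => f (ω n)) μX z (pathCyl k x) = 0 := by
  have hs := measurableSet_pathCyl k (fun n => f (x n))
  have h := setLIntegral_condDistrib_id (μ := μX) (measurable_map_path (f := f))
    (measurableSet_pathCyl k x) hs.compl
  rw [hfX] at h
  have h0 : (fun (ω : ℕ → A) n => f (ω n)) ⁻¹' (pathCyl k fun n => f (x n))ᶜ ∩ pathCyl k x
      = ∅ := by
    rw [Set.eq_empty_iff_forall_notMem]
    rintro ω ⟨h1, h2⟩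
    exact h1 fun i hi => congrArg f (h2 i hi)
  rw [h0, measure_empty, setLIntegral_eq_zero_iff hs.compl (Kernel.measurable_coe _
    (measurableSet_pathCyl k x))] at h
  exact h

/-- The conditional probability of a cylinder given the image path is, up to a constant, a
function of the future of the image path which only depends on the endpoint of the cylinder. -/
lemma IsInhomMarkovChain.exists_restart_density (hX : IsInhomMarkovChain αX PX μX)
    [IsFiniteMeasure μX] [IsFiniteMeasure μZ]
    (hfX : μX.map (fun ω n => f (ω n)) = μZ) (k : ℕ) (u : A)
    (R : Measure (ℕ → C)) [IsFiniteMeasure R] :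
    ∃ h : (ℕ → C) → ℝ≥0∞, ∀ x : ℕ → A, x k = u →
      (μZ.restrict (pathCyl k fun n => f (x n))).map (fun ω n => ω (k + n))
        = μZ (pathCyl k fun n => f (x n)) • R →
      μZ (pathCyl k fun n => f (x n)) ≠ 0 →
      (fun ζ => condDistrib id (fun (ω : ℕ → A) n => f (ω n)) μX
        (concatPath k (fun n => f (x n)) ζ) (pathCyl k x))
      =ᵐ[R] fun ζ => μX (pathCyl k x) / μZ (pathCyl k fun n => f (x n)) * h ζ := by
  obtain ⟨L, hLfin, hL⟩ := hX.exists_restart k u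
  refine ⟨(L.map fun ω n => f (ω n)).rnDeriv R, fun x hxu hR h0 => ?_⟩
  refine comp_ae_eq_rnDeriv (φ := fun z => condDistrib id (fun (ω : ℕ → A) n => f (ω n)) μX z
      (pathCyl k x)) (θ := fun ω n => ω (k + n))
    (measurableSet_pathCyl k fun n => f (x n)) (by fun_prop)
    (measurable_concatPath _ _) (Kernel.measurable_coe _ (measurableSet_pathCyl k x))
    (fun _ he => concatPath_shift he) hR h0 (measure_ne_top _ _) (measure_ne_top _ _) ?_
  intro t ht
  have hθ : Measurable (fun (ω : ℕ → C) (n : ℕ) => ω (k + n)) := by fun_prop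
  have e := setLIntegral_condDistrib_id (μ := μX) (measurable_map_path (f := f))
    (measurableSet_pathCyl k x) ((hθ ht).inter (measurableSet_pathCyl k fun n => f (x n)))
  rw [hfX] at e
  have hset : (fun (ω : ℕ → A) n => f (ω n)) ⁻¹'
        ((fun (ω : ℕ → C) n => ω (k + n)) ⁻¹' t ∩ pathCyl k fun n => f (x n)) ∩ pathCyl k x
      = (fun (ω : ℕ → A) n => ω (k + n)) ⁻¹' ((fun (ω : ℕ → A) n => f (ω n)) ⁻¹' t)
        ∩ pathCyl k x := by
    ext ω
    constructor
    · rintro ⟨⟨h1, -⟩, h2⟩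
      exact ⟨h1, h2⟩
    · rintro ⟨h1, h2⟩
      exact ⟨⟨h1, fun i hi => congrArg f (h2 i hi)⟩, h2⟩
  have ht' := measurable_map_path (f := f) ht
  have hA : Measurable (fun (ω : ℕ → A) (n : ℕ) => ω (k + n)) := by fun_prop
  rw [e, hset, Measure.map_apply measurable_map_path ht, ← smul_eq_mul, ← Measure.smul_apply,
    ← hL x hxu, Measure.map_apply hA ht', Measure.restrict_apply (hA ht')]

end Image

section Coupling

variable {A B C : Type*} [Countable A] [Countable B] [Countable C]
  [MeasurableSpace A] [MeasurableSingletonClass A]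
  [MeasurableSpace B] [MeasurableSingletonClass B]
  [MeasurableSpace C] [MeasurableSingletonClass C]
  {αX : A → ℝ≥0∞} {PX : ℕ → A → A → ℝ≥0∞} {μX : Measure (ℕ → A)}
  {αY : B → ℝ≥0∞} {PY : ℕ → B → B → ℝ≥0∞} {μY : Measure (ℕ → B)}
  {αZ : C → ℝ≥0∞} {PZ : ℕ → C → C → ℝ≥0∞} {μZ : Measure (ℕ → C)}
  {f : A → C} {g : B → C} [Nonempty (ℕ → A)] [Nonempty (ℕ → B)]

/-- Cylinder probabilities of the conditionally independent coupling. -/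
lemma exists_lintegral_condDistrib_pathCyl_mul [IsFiniteMeasure μX] [IsFiniteMeasure μY]
    [IsFiniteMeasure μZ]
    (hX : IsInhomMarkovChain αX PX μX) (hY : IsInhomMarkovChain αY PY μY)
    (hZ : IsInhomMarkovChain αZ PZ μZ)
    (hfX : μX.map (fun ω n => f (ω n)) = μZ) (hgY : μY.map (fun ω n => g (ω n)) = μZ) (k : ℕ) :
    ∃ H : A → B → ℝ≥0∞, ∀ (x : ℕ → A) (y : ℕ → B),
      ∫⁻ z, condDistrib id (fun (ω : ℕ → A) n => f (ω n)) μX z (pathCyl k x) *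
        condDistrib id (fun (ω : ℕ → B) n => g (ω n)) μY z (pathCyl k y) ∂μZ
      = if ∀ i ≤ k, f (x i) = g (y i) then
          μX (pathCyl k x) * μY (pathCyl k y) / μZ (pathCyl k fun n => f (x n)) * H (x k) (y k)
        else 0 := by
  choose R hRfin hR using hZ.exists_restart k
  choose hx hhx using fun a => hX.exists_restart_density hfX k a (R (f a))
  choose hy hhy using fun (a : A) b => hY.exists_restart_density hgY k b (R (f a))
  refine ⟨fun a b => ∫⁻ ζ, hx a ζ * hy a b ζ ∂(R (f a)), fun x y => ?_⟩
  set F : (ℕ → A) → ℕ → C := fun ω n => f (ω n) with hF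
  set G : (ℕ → B) → ℕ → C := fun ω n => g (ω n) with hG
  have hx0 : ∀ᵐ z ∂μZ, z ∉ pathCyl k (F x) → condDistrib id F μX z (pathCyl k x) = 0 :=
    ae_condDistrib_pathCyl_eq_zero hfX k x
  have hy0 : ∀ᵐ z ∂μZ, z ∉ pathCyl k (G y) → condDistrib id G μY z (pathCyl k y) = 0 :=
    ae_condDistrib_pathCyl_eq_zero hgY k y
  split_ifs with hxy
  · have hcyl : pathCyl k (G y) = pathCyl k (F x) :=
      pathCyl_congr fun i hi => (hxy i hi).symm
    have hconcat : concatPath k (G y) = concatPath k (F x) := by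
      funext ζ i
      unfold concatPath
      split_ifs with hi
      · exact (hxy i hi.le).symm
      · rfl
    have hs := measurableSet_pathCyl k (F x)
    set s := pathCyl k (F x) with hsdef
    have hφ := Kernel.measurable_coe (condDistrib id F μX) (measurableSet_pathCyl k x)
    have hψ := Kernel.measurable_coe (condDistrib id G μY) (measurableSet_pathCyl k y)
    by_cases h0 : μZ s = 0
    · have hX0 : μX (pathCyl k x) = 0 :=
        le_antisymm ((measure_pathCyl_le_map hfX k x).trans_eq h0) zero_le
      rw [hX0, zero_mul, ENNReal.zero_div, zero_mul]
      refine (lintegral_congr_ae (g := fun _ => 0) ?_).trans lintegral_zero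
      filter_upwards [hx0, measure_eq_zero_iff_ae_notMem.1 h0] with z h1 h2
      rw [h1 h2, zero_mul]
    have hRx : (μZ.restrict s).map (fun ω n => ω (k + n)) = μZ s • R (f (x k)) :=
      hR (f (x k)) (F x) rfl
    have ex := hhx (x k) x rfl hRx h0
    have ey := hhy (x k) (y k) y rfl (by rw [hcyl]; exact hRx) (by rw [hcyl]; exact h0)
    rw [hconcat, hcyl] at ey
    have hp := measure_ne_top μZ s
    have hθ : Measurable (fun (ω : ℕ → C) (n : ℕ) => ω (k + n)) := by fun_prop
    calc ∫⁻ z, condDistrib id F μX z (pathCyl k x) * condDistrib id G μY z (pathCyl k y) ∂μZ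
        = ∫⁻ z in s, condDistrib id F μX z (pathCyl k x) *
            condDistrib id G μY z (pathCyl k y) ∂μZ := by
          rw [← lintegral_indicator hs]
          refine lintegral_congr_ae ?_
          filter_upwards [hx0] with z h1
          by_cases hz : z ∈ s
          · rw [Set.indicator_of_mem hz]
          · rw [Set.indicator_of_notMem hz, h1 hz, zero_mul]
      _ = ∫⁻ z in s, condDistrib id F μX (concatPath k (F x) fun n => z (k + n)) (pathCyl k x) *
            condDistrib id G μY (concatPath k (F x) fun n => z (k + n)) (pathCyl k y) ∂μZ :=
          setLIntegral_congr_fun hs fun z hz => by simp only [concatPath_shift hz]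
      _ = ∫⁻ ζ, condDistrib id F μX (concatPath k (F x) ζ) (pathCyl k x) *
            condDistrib id G μY (concatPath k (F x) ζ) (pathCyl k y)
            ∂((μZ.restrict s).map fun ω n => ω (k + n)) :=
          (lintegral_map (f := fun ζ => condDistrib id F μX (concatPath k (F x) ζ) (pathCyl k x) *
            condDistrib id G μY (concatPath k (F x) ζ) (pathCyl k y))
            ((hφ.comp (measurable_concatPath k _)).mul (hψ.comp (measurable_concatPath k _)))
            hθ).symm
      _ = μZ s * ∫⁻ ζ, (μX (pathCyl k x) / μZ s * (μY (pathCyl k y) / μZ s)) *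
            (hx (x k) ζ * hy (x k) (y k) ζ) ∂(R (f (x k))) := by
          rw [hRx, lintegral_smul_measure, smul_eq_mul]
          congr 1
          refine lintegral_congr_ae ?_
          filter_upwards [ex, ey] with ζ h1 h2
          rw [h1, h2, mul_mul_mul_comm]
      _ = _ := by
          rw [lintegral_const_mul' _ _ (ENNReal.mul_ne_top
            (ENNReal.div_ne_top (measure_ne_top _ _) h0)
            (ENNReal.div_ne_top (measure_ne_top _ _) h0)), ← mul_assoc, ← mul_assoc,
            ENNReal.mul_div_cancel h0 hp, mul_div_assoc]
  · refine (lintegral_congr_ae (g := fun _ => 0) ?_).trans lintegral_zero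
    filter_upwards [hx0, hy0] with z h1 h2
    by_cases hz : z ∈ pathCyl k (F x)
    · rw [h2 (fun hz' => hxy fun i hi => (hz i hi).symm.trans (hz' i hi)), mul_zero]
    · rw [h1 hz, zero_mul]

end Coupling

/-- **Inhomogeneous coupling.** If (possibly time-inhomogeneous) Markov chains `X̄`, `Ȳ` have a
common image (possibly time-inhomogeneous) Markov chain `Z̄` under maps `f`, `g`, then there is a
(possibly time-inhomogeneous) Markov coupling `(X,Y)` with `f(X_t) = g(Y_t)` for all `t`, whose
marginals are `X̄` and `Ȳ`, conditionally independent given `(f(X_t))_t`. -/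
theorem statement_1
    {A B C : Type*} [Countable A] [Countable B] [Countable C]
    [MeasurableSpace A] [MeasurableSingletonClass A]
    [MeasurableSpace B] [MeasurableSingletonClass B]
    [MeasurableSpace C] [MeasurableSingletonClass C]
    (αX : A → ℝ≥0∞) (PX : ℕ → A → A → ℝ≥0∞) (μX : Measure (ℕ → A))
    (αY : B → ℝ≥0∞) (PY : ℕ → B → B → ℝ≥0∞) (μY : Measure (ℕ → B))
    (αZ : C → ℝ≥0∞) (PZ : ℕ → C → C → ℝ≥0∞) (μZ : Measure (ℕ → C))
    (f : A → C) (g : B → C)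
    (hX : IsInhomMarkovChain αX PX μX) (hY : IsInhomMarkovChain αY PY μY)
    (hZ : IsInhomMarkovChain αZ PZ μZ)
    (hfX : μX.map (fun ω n => f (ω n)) = μZ)
    (hgY : μY.map (fun ω n => g (ω n)) = μZ) :
    ∃ (αW : A × B → ℝ≥0∞) (PW : ℕ → A × B → A × B → ℝ≥0∞) (μW : Measure (ℕ → A × B)),
      IsInhomMarkovChain αW PW μW ∧
      μW.map (fun ω n => (ω n).1) = μX ∧
      μW.map (fun ω n => (ω n).2) = μY ∧
      (∀ᵐ ω ∂μW, ∀ t : ℕ, f (ω t).1 = g (ω t).2) ∧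
      CondIndepGiven μW (fun ω n => f (ω n).1) (fun ω n => (ω n).1) (fun ω n => (ω n).2) := by
  have hX1 := hX.1
  have hY1 := hY.1
  have hZ1 := hZ.1
  have : Nonempty (ℕ → A) := nonempty_of_isProbabilityMeasure μX
  have : Nonempty (ℕ → B) := nonempty_of_isProbabilityMeasure μY
  obtain ⟨π, hπ, hπ1, hπ2, hπae, hπmap⟩ := exists_condIndep_coupling
    (measurable_map_path (f := f)) (measurable_map_path (f := g)) hfX hgY
  set κ := condDistrib id (fun (ω : ℕ → A) n => f (ω n)) μX
  set η := condDistrib id (fun (ω : ℕ → B) n => g (ω n)) μY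
  have hpair : Measurable (fun (w : (ℕ → A) × (ℕ → B)) n => (w.1 n, w.2 n)) := by fun_prop
  have hm1 : Measurable (fun (ω : ℕ → A × B) n => (ω n).1) := by fun_prop
  have hm2 : Measurable (fun (ω : ℕ → A × B) n => (ω n).2) := by fun_prop
  have hmf : Measurable (fun (ω : ℕ → A × B) n => f (ω n).1) := by fun_prop
  set μW : Measure (ℕ → A × B) := π.map fun w n => (w.1 n, w.2 n) with hμW
  have hW1 : IsProbabilityMeasure μW := Measure.isProbabilityMeasure_map hpair.aemeasurable
  have htriple : μW.map (fun ω => ((fun n => f (ω n).1), (fun n => (ω n).1), fun n => (ω n).2))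
      = μZ ⊗ₘ (κ ×ₖ η) := by
    rw [hμW, Measure.map_map (by fun_prop) hpair, ← hπmap]
    rfl
  have hfst : μW.map (fun ω n => (ω n).1) = μX := by
    rw [hμW, Measure.map_map hm1 hpair]
    exact hπ1
  have hsnd : μW.map (fun ω n => (ω n).2) = μY := by
    rw [hμW, Measure.map_map hm2 hpair]
    exact hπ2
  have hfZ : μW.map (fun ω n => f (ω n).1) = μZ := by
    rw [← hfX, ← hfst, Measure.map_map measurable_map_path hm1]
    rfl
  have hcyl : ∀ k (w : ℕ → A × B), μW (pathCyl k w) =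
      ∫⁻ z, κ z (pathCyl k fun n => (w n).1) * η z (pathCyl k fun n => (w n).2) ∂μZ := by
    intro k w
    have hs := (measurableSet_pathCyl k fun n => (w n).1).prod
      (measurableSet_pathCyl k fun n => (w n).2)
    have h1 := congrArg (fun ρ => ρ (Set.univ ×ˢ ((pathCyl k fun n => (w n).1) ×ˢ
      (pathCyl k fun n => (w n).2)))) htriple
    beta_reduce at h1
    rw [Measure.map_apply (by fun_prop) (MeasurableSet.univ.prod hs),
      Measure.compProd_apply_prod MeasurableSet.univ hs, setLIntegral_univ] at h1
    simp_rw [Kernel.prod_apply, Measure.prod_prod] at h1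
    rw [← h1]
    congr 1
    ext ω
    simp only [pathCyl, Set.mem_ofPred_eq, Set.mem_preimage, Set.mem_prod, Set.mem_univ, true_and,
      Prod.ext_iff, ← forall_and]
  choose H hH using exists_lintegral_condDistrib_pathCyl_mul hX hY hZ hfX hgY
  obtain ⟨v, P, hP⟩ := exists_isInhomMarkovChain μW fun k => by
    refine ⟨fun w => if ∀ i ≤ k, f (w i).1 = g (w i).2 then
        μX (pathCyl k fun n => (w n).1) * μY (pathCyl k fun n => (w n).2) /
          μZ (pathCyl k fun n => f (w n).1) else 0,
      fun u u' => if f u'.1 = g u'.2 then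
        PX (k + 1) u.1 u'.1 * PY (k + 1) u.2 u'.2 / PZ (k + 1) (f u.1) (f u'.1) *
          H (k + 1) u'.1 u'.2 else 0, fun ω u => ?_⟩
    have hupd : ∀ i ≤ k, Function.update ω (k + 1) u i = ω i :=
      fun i hi => Function.update_of_ne (by omega) _ _
    have hiff : (∀ i ≤ k + 1, f (Function.update ω (k + 1) u i).1 =
        g (Function.update ω (k + 1) u i).2) ↔
        (∀ i ≤ k, f (ω i).1 = g (ω i).2) ∧ f u.1 = g u.2 := by
      constructor
      · intro h
        refine ⟨fun i hi => ?_, ?_⟩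
        · have := h i (by omega)
          rwa [hupd i hi] at this
        · simpa using h (k + 1) le_rfl
      · rintro ⟨h1, h2⟩ i hi
        rcases eq_or_ne i (k + 1) with rfl | hne
        · simpa using h2
        · rw [hupd i (by omega)]
          exact h1 i (by omega)
    rw [hcyl, hH, hX.measure_pathCyl_succ, hY.measure_pathCyl_succ, hZ.measure_pathCyl_succ,
      pathCyl_congr fun i hi => congrArg Prod.fst (hupd i hi),
      pathCyl_congr fun i hi => congrArg Prod.snd (hupd i hi),
      pathCyl_congr fun i hi => congrArg (fun q => f q.1) (hupd i hi), hupd k le_rfl,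
      Function.update_self]
    simp only [hiff]
    by_cases h1 : ∀ i ≤ k, f (ω i).1 = g (ω i).2
    · by_cases h2 : f u.1 = g u.2
      · rw [if_pos ⟨h1, h2⟩, if_pos h1, if_pos h2]
        simp only [div_eq_mul_inv]
        rw [ENNReal.mul_inv (Or.inr (hZ.apply_ne_top _ _ _)) (Or.inl (measure_ne_top _ _))]
        ring
      · simp [h2]
    · rw [if_neg (fun h => h1 h.1), if_neg h1, zero_mul]
  refine ⟨v, P, μW, hP, hfst, hsnd, ?_, ?_⟩
  · rw [hμW]
    have hdiag : MeasurableSet {ω : ℕ → A × B | ∀ t, f (ω t).1 = g (ω t).2} := by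
      simp only [Set.ofPred_forall]
      exact MeasurableSet.iInter fun t =>
        measurableSet_eq_fun (by fun_prop) (by fun_prop)
    rw [ae_map_iff hpair.aemeasurable hdiag]
    filter_upwards [hπae] with w hw t using congrFun hw t
  · exact condIndepGiven_of_map_eq_compProd hmf hm1 hm2 (by rw [htriple, hfZ])
end

section
/- Let X̄, Ȳ, Z̄ be stationary time-homogeneous Markov chains with time indexed by ℤ and countable state spaces A, B, C, and let f: A → C and g: B → C be maps such that (f(X̄_t))_{t∈ℤ} =ᵈ Z̄ =ᵈ (g(Ȳ_t))_{t∈ℤ}. Then there exists a stationary time-homogeneous Markov chain (X_t, Y_t)_{t∈ℤ} with values in A×B such that (X_t)_{t∈ℤ} =ᵈ X̄, (Y_t)_{t∈ℤ} =ᵈ Ȳ, almost surely f(X_t) = g(Y_t) for all t ∈ ℤ, and moreover (X_t)_{t∈ℤ} and (Y_t)_{t∈ℤ} may be taken conditionally independent given the process (f(X_t))_{t∈ℤ}. -/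
open MeasureTheory Filter Topology
open scoped ENNReal Classical

/-- `μ` is the law on two-sided path space of a stationary time-homogeneous Markov chain with
stationary one-dimensional distribution `π` and transition matrix `P`: every cylinder probability,
started at any time `t ∈ ℤ`, is given by `π` and `P` (in particular the law is shift-invariant). -/
def IsStatMarkovChainZ {U : Type*} [MeasurableSpace U]
    (π : U → ℝ≥0∞) (P : U → U → ℝ≥0∞) (μ : Measure (ℤ → U)) : Prop :=
  IsProbabilityMeasure μ ∧ IsProbVec π ∧ IsStochastic P ∧
    ∀ (t : ℤ) (k : ℕ) (a : ℕ → U),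
      μ {ω | ∀ i ≤ k, ω (t + (i : ℤ)) = a i}
        = π (a 0) * ∏ i ∈ Finset.range k, P (a i) (a (i + 1))

/-- `φ` is the conditional probability of the event `S` given the factor map `F`, as a density on
the target of `F`. -/
def IsFactorDensity {Ω Ω' : Type*} [MeasurableSpace Ω] [MeasurableSpace Ω']
    (μ : Measure Ω) (F : Ω → Ω') (S : Set Ω) (φ : Ω' → ℝ≥0∞) : Prop :=
  Measurable φ ∧ (μ.restrict S).map F = (μ.map F).withDensity φ

section FactorDensity

variable {Ω Ω' : Type*} [MeasurableSpace Ω] [MeasurableSpace Ω'] {μ : Measure Ω} {F : Ω → Ω'}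
  {S : Set Ω} {φ : Ω' → ℝ≥0∞}

lemma IsFactorDensity.of_setLIntegral_eq (hF : Measurable F)
    (hφ : Measurable φ)
    (h : ∀ D, MeasurableSet D → ∫⁻ z in D, φ z ∂(μ.map F) = μ (F ⁻¹' D ∩ S)) :
    IsFactorDensity μ F S φ := by
  refine ⟨hφ, Measure.ext fun D hD => ?_⟩
  rw [Measure.map_apply hF hD, Measure.restrict_apply (hF hD), withDensity_apply _ hD, h D hD]

lemma IsFactorDensity.setLIntegral_eq (h : IsFactorDensity μ F S φ) (hF : Measurable F)
    {D : Set Ω'} (hD : MeasurableSet D) :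
    ∫⁻ z in D, φ z ∂(μ.map F) = μ (F ⁻¹' D ∩ S) := by
  rw [← withDensity_apply _ hD, ← h.2, Measure.map_apply hF hD, Measure.restrict_apply (hF hD)]

lemma IsFactorDensity.ae_eq [IsFiniteMeasure μ] {ψ : Ω' → ℝ≥0∞}
    (h : IsFactorDensity μ F S φ) (h' : IsFactorDensity μ F S ψ) : φ =ᵐ[μ.map F] ψ :=
  (withDensity_eq_iff_of_sigmaFinite h.1.aemeasurable h'.1.aemeasurable).1 (h.2.symm.trans h'.2)

lemma IsFactorDensity.univ : IsFactorDensity μ F Set.univ 1 :=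
  ⟨measurable_one, by simp⟩

lemma IsFactorDensity.inter_preimage (h : IsFactorDensity μ F S φ) (hF : Measurable F)
    {D : Set Ω'} (hD : MeasurableSet D) :
    IsFactorDensity μ F (S ∩ F ⁻¹' D) (D.indicator φ) := by
  refine .of_setLIntegral_eq hF (h.1.indicator hD) fun E hE => ?_
  rw [setLIntegral_indicator hD, h.setLIntegral_eq hF (hD.inter hE)]
  congr 1
  ext; simp; tauto

lemma IsFactorDensity.preimage (hF : Measurable F) {D : Set Ω'} (hD : MeasurableSet D) :
    IsFactorDensity μ F (F ⁻¹' D) (D.indicator 1) := by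
  simpa using IsFactorDensity.univ.inter_preimage (μ := μ) hF hD

lemma isFactorDensity_condDistrib [StandardBorelSpace Ω] [Nonempty Ω] [IsFiniteMeasure μ]
    (hF : Measurable F) (hS : MeasurableSet S) :
    IsFactorDensity μ F S (fun z => ProbabilityTheory.condDistrib id F μ z S) := by
  refine .of_setLIntegral_eq hF (ProbabilityTheory.Kernel.measurable_coe _ hS) fun D hD => ?_
  have h : (μ.map F).compProd (ProbabilityTheory.condDistrib id F μ) = μ.map fun a => (F a, id a) :=
    ProbabilityTheory.compProd_map_condDistrib aemeasurable_id
  rw [← Measure.compProd_apply_prod hD hS, h, Measure.map_apply (by fun_prop) (hD.prod hS)]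
  rfl

end FactorDensity

/-- The relatively independent coupling of two measures over a common factor. -/
lemma exists_relIndep_coupling {Ω₁ Ω₂ Ω' : Type*} [MeasurableSpace Ω₁] [MeasurableSpace Ω₂]
    [MeasurableSpace Ω'] [StandardBorelSpace Ω₁] [StandardBorelSpace Ω₂]
    (μ₁ : Measure Ω₁) (μ₂ : Measure Ω₂) [IsProbabilityMeasure μ₁] [IsProbabilityMeasure μ₂]
    {F : Ω₁ → Ω'} {G : Ω₂ → Ω'} (hF : Measurable F) (hG : Measurable G)
    (hFG : μ₁.map F = μ₂.map G) :
    ∃ ν : Measure (Ω₁ × Ω₂), IsProbabilityMeasure ν ∧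
      ∀ S T φ ψ, MeasurableSet S → MeasurableSet T → IsFactorDensity μ₁ F S φ →
        IsFactorDensity μ₂ G T ψ → ν (S ×ˢ T) = ∫⁻ z, φ z * ψ z ∂(μ₁.map F) := by
  have := nonempty_of_isProbabilityMeasure μ₁
  have := nonempty_of_isProbabilityMeasure μ₂
  have := Measure.isProbabilityMeasure_map (μ := μ₁) hF.aemeasurable
  refine ⟨(μ₁.map F).bind
    ((ProbabilityTheory.condDistrib id F μ₁).prod (ProbabilityTheory.condDistrib id G μ₂)),
    inferInstance, fun S T φ ψ hS hT hφ hψ => ?_⟩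
  rw [Measure.bind_apply (hS.prod hT) (ProbabilityTheory.Kernel.aemeasurable _)]
  refine lintegral_congr_ae ?_
  have h1 := hφ.ae_eq (isFactorDensity_condDistrib hF hS)
  have h2 := hψ.ae_eq (isFactorDensity_condDistrib hG hT)
  rw [← hFG] at h2
  filter_upwards [h1, h2] with z hz1 hz2
  rw [ProbabilityTheory.Kernel.prod_apply, Measure.prod_prod, hz1, hz2]

/-- Finite measures on a product of countable discrete spaces are determined by cylinders over a
cofinal family of finite index sets. -/
lemma ext_of_cofinal_cylinders {ι U : Type*} [Countable U] [MeasurableSpace U]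
    [MeasurableSingletonClass U] {μ ν : Measure (ι → U)} [IsFiniteMeasure μ]
    (h : ∀ I : Finset ι, ∃ J : Finset ι, I ⊆ J ∧
      ∀ b : ι → U, μ {ω | ∀ i ∈ J, ω i = b i} = ν {ω | ∀ i ∈ J, ω i = b i}) : μ = ν := by
  rcases isEmpty_or_nonempty (ι → U) with hE | ⟨⟨ω₀⟩⟩
  · exact Measure.ext fun s _ => by simp [Set.eq_empty_of_isEmpty s]
  refine IsProjectiveLimit.unique (P := fun I => μ.map I.restrict) (fun I => rfl) fun I => ?_
  obtain ⟨J, hIJ, hJ⟩ := h I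
  have key : ν.map J.restrict = μ.map J.restrict := by
    refine Measure.ext_of_singleton fun b => ?_
    have hb : J.restrict ⁻¹' ({b} : Set (J → U)) =
        {ω : ι → U | ∀ i ∈ J, ω i = if hi : i ∈ J then b ⟨i, hi⟩ else ω₀ i} := by
      ext ω
      simp only [Set.mem_preimage, Set.mem_singleton_iff, Set.mem_ofPred_eq, funext_iff,
        Finset.restrict, Subtype.forall]
      exact forall₂_congr fun i hi => by simp [hi]
    rw [Measure.map_apply (by fun_prop) (.singleton b),
      Measure.map_apply (by fun_prop) (.singleton b), hb, hJ]
  have hr : (I.restrict : (ι → U) → _) = Finset.restrict₂ hIJ ∘ J.restrict := rfl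
  simp only [hr]
  rw [← Measure.map_map (by fun_prop) (by fun_prop), key,
    Measure.map_map (by fun_prop) (by fun_prop)]

section MarkovChain

variable {U : Type*}

/-- The reversed past of a two-sided path seen from time `t`. -/
def pastAt (t : ℤ) (ω : ℤ → U) : ℕ → U := fun n => ω (t - n)

/-- The future of a two-sided path seen from time `t`. -/
def futureAt (t : ℤ) (ω : ℤ → U) : ℕ → U := fun n => ω (t + n)

variable [MeasurableSpace U]

lemma measurable_pastAt (t : ℤ) : Measurable (pastAt t : (ℤ → U) → ℕ → U) := by
  unfold pastAt; fun_prop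

lemma measurable_futureAt (t : ℤ) : Measurable (futureAt t : (ℤ → U) → ℕ → U) := by
  unfold futureAt; fun_prop

variable {π : U → ℝ≥0∞} {P : U → U → ℝ≥0∞} {μ : Measure (ℤ → U)}

lemma IsStatMarkovChainZ.measure_eval_eq (h : IsStatMarkovChainZ π P μ) (t : ℤ) (x : U) :
    μ {ω | ω t = x} = π x := by
  simpa using h.2.2.2 t 0 (fun _ => x)

lemma IsStatMarkovChainZ.cylinder_mul (h : IsStatMarkovChainZ π P μ) (t : ℤ) (x : U) (m n : ℕ)
    (a b : ℕ → U) :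
    π x * μ ({ω | ω t = x} ∩ ({ω | ∀ i ≤ m, pastAt t ω i = a i} ∩
      {ω | ∀ i ≤ n, futureAt t ω i = b i})) =
    μ ({ω | ω t = x} ∩ {ω | ∀ i ≤ m, pastAt t ω i = a i}) *
      μ ({ω | ω t = x} ∩ {ω | ∀ i ≤ n, futureAt t ω i = b i}) := by
  have hp : ∀ a : ℕ → U, a 0 ≠ x → {ω | ω t = x} ∩ {ω | ∀ i ≤ m, pastAt t ω i = a i} = ∅ := by
    intro a ha
    ext ω
    simp only [Set.mem_inter_iff, Set.mem_ofPred_eq, Set.mem_empty_iff_false, iff_false]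
    rintro ⟨h1, h2⟩
    exact ha (by rw [← h2 0 (Nat.zero_le _), ← h1]; simp [pastAt])
  have hf : ∀ a : ℕ → U, a 0 ≠ x → {ω | ω t = x} ∩ {ω | ∀ i ≤ n, futureAt t ω i = a i} = ∅ := by
    intro a ha
    ext ω
    simp only [Set.mem_inter_iff, Set.mem_ofPred_eq, Set.mem_empty_iff_false, iff_false]
    rintro ⟨h1, h2⟩
    exact ha (by rw [← h2 0 (Nat.zero_le _), ← h1]; simp [futureAt])
  by_cases ha : a 0 = x
  swap
  · rw [← Set.inter_assoc, hp a ha]; simp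
  by_cases hb : b 0 = x
  swap
  · rw [Set.inter_left_comm, hf b hb]; simp
  set c : ℕ → U := fun i => if i ≤ m then a (m - i) else b (i - m) with hc
  have hcb : ∀ j, c (m + j) = b j := by
    intro j
    rcases Nat.eq_zero_or_pos j with rfl | hj
    · simp [hc, ha, hb]
    · simp [hc, show ¬ (m + j ≤ m) by omega]
  have e1 : {ω : ℤ → U | ω t = x} ∩ {ω | ∀ i ≤ m, pastAt t ω i = a i} =
      {ω | ∀ i ≤ m, ω ((t - m) + (i : ℤ)) = c i} := by
    ext ω
    simp only [Set.mem_inter_iff, Set.mem_ofPred_eq, pastAt]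
    constructor
    · rintro ⟨-, h2⟩ i hi
      have := h2 (m - i) (by omega)
      simp only [hc, if_pos hi, ← this]
      congr 1
      omega
    · intro H
      have H' : ∀ i ≤ m, ω (t - i) = a i := by
        intro i hi
        have := H (m - i) (by omega)
        rw [hc] at this
        simp only [show m - i ≤ m by omega, if_true, show m - (m - i) = i by omega] at this
        rw [← this]
        congr 1
        omega
      exact ⟨by simpa [ha] using H' 0 (Nat.zero_le _), H'⟩
  have e2 : {ω : ℤ → U | ω t = x} ∩ {ω | ∀ i ≤ n, futureAt t ω i = b i} =
      {ω | ∀ i ≤ n, ω (t + (i : ℤ)) = b i} := by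
    ext ω
    simp only [Set.mem_inter_iff, Set.mem_ofPred_eq, futureAt, and_iff_right_iff_imp]
    intro H
    simpa [hb] using H 0 (Nat.zero_le _)
  have e3 : {ω : ℤ → U | ω t = x} ∩ ({ω | ∀ i ≤ m, pastAt t ω i = a i} ∩
      {ω | ∀ i ≤ n, futureAt t ω i = b i}) =
      {ω | ∀ i ≤ m + n, ω ((t - m) + (i : ℤ)) = c i} := by
    rw [Set.inter_inter_distrib_left, e1, e2]
    ext ω
    simp only [Set.mem_inter_iff, Set.mem_ofPred_eq]
    constructor
    · rintro ⟨h1, h2⟩ i hi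
      rcases le_or_gt i m with him | him
      · exact h1 i him
      · obtain ⟨j, rfl⟩ := Nat.exists_eq_add_of_le him.le
        rw [hcb, ← h2 j (by omega)]
        congr 1
        push_cast
        ring
    · intro H
      refine ⟨fun i hi => H i (by omega), fun j hj => ?_⟩
      rw [← hcb, ← H (m + j) (by omega)]
      congr 1
      push_cast
      ring
  rw [e3, e1, e2, h.2.2.2, h.2.2.2, h.2.2.2, Finset.prod_range_add, hb]
  simp only [add_assoc, hcb]
  ring

variable [MeasurableSingletonClass U]

lemma measurableSet_eval_eq {ι : Type*} (t : ι) (x : U) :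
    MeasurableSet {ω : ι → U | ω t = x} :=
  (MeasurableSet.singleton x).preimage (measurable_pi_apply t)

lemma measurableSet_cylinder_nat (n : ℕ) (b : ℕ → U) :
    MeasurableSet {ω : ℕ → U | ∀ i ≤ n, ω i = b i} := by
  have : {ω : ℕ → U | ∀ i ≤ n, ω i = b i} = ⋂ i ≤ n, {ω : ℕ → U | ω i = b i} := by
    ext; simp
  rw [this]
  exact .iInter fun i => .iInter fun _ => measurableSet_eval_eq i _

lemma measurableSet_cylinder_int (t : ℤ) (n : ℕ) (b : ℕ → U) :
    MeasurableSet {ω : ℤ → U | ∀ i ≤ n, ω (t + (i : ℤ)) = b i} :=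
  measurable_futureAt t (measurableSet_cylinder_nat n b)

variable [Countable U]

lemma ext_of_cylinders_nat {μ ν : Measure (ℕ → U)} [IsFiniteMeasure μ]
    (h : ∀ (n : ℕ) (b : ℕ → U), μ {ω | ∀ i ≤ n, ω i = b i} = ν {ω | ∀ i ≤ n, ω i = b i}) :
    μ = ν := by
  refine ext_of_cofinal_cylinders fun I => ⟨Finset.range (I.sup id + 1), fun i hi => ?_, fun b => ?_⟩
  · exact Finset.mem_range_succ_iff.2 (Finset.le_sup (f := id) hi)
  · simpa only [Finset.mem_range_succ_iff] using h _ b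

lemma ext_of_cylinders_int {μ ν : Measure (ℤ → U)} [IsFiniteMeasure μ]
    (h : ∀ (t : ℤ) (n : ℕ) (b : ℕ → U), μ {ω | ∀ i ≤ n, ω (t + (i : ℤ)) = b i} =
      ν {ω | ∀ i ≤ n, ω (t + (i : ℤ)) = b i}) :
    μ = ν := by
  refine ext_of_cofinal_cylinders fun I => ?_
  set m := I.sup Int.natAbs
  refine ⟨Finset.Icc (-(m : ℤ)) m, fun i hi => ?_, fun b => ?_⟩
  · have : i.natAbs ≤ m := Finset.le_sup (f := Int.natAbs) hi
    rw [Finset.mem_Icc]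
    omega
  · convert h (-m) (2 * m) (fun i => b (-m + i)) using 3 <;>
    · ext ω
      simp only [Finset.mem_Icc]
      refine ⟨fun H i hi => H _ (by omega), fun H i hi => ?_⟩
      have := H (i + m).toNat (by omega)
      rwa [show -(m : ℤ) + ((i + m).toNat : ℤ) = i by omega] at this

lemma IsStatMarkovChainZ.map_shift (h : IsStatMarkovChainZ π P μ) (s : ℤ) :
    μ.map (fun ω t => ω (s + t)) = μ := by
  have := h.1
  have hm : Measurable (fun (ω : ℤ → U) t => ω (s + t)) := by fun_prop
  refine ext_of_cylinders_int fun t n b => ?_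
  rw [Measure.map_apply hm (measurableSet_cylinder_int t n b), h.2.2.2 t n b,
    ← h.2.2.2 (s + t) n b]
  simp only [Set.preimage_ofPred_eq, add_assoc]

/-- The past and the future of a Markov chain are independent given the present. -/
lemma IsStatMarkovChainZ.past_prod_future (h : IsStatMarkovChainZ π P μ) (t : ℤ) (x : U) :
    ((μ.restrict {ω | ω t = x}).map (pastAt t)).prod ((μ.restrict {ω | ω t = x}).map (futureAt t)) =
      π x • (μ.restrict {ω | ω t = x}).map (fun ω => (pastAt t ω, futureAt t ω)) := by
  have := h.1
  have hp := measurable_pastAt (U := U) t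
  have hq := measurable_futureAt (U := U) t
  have hx := measurableSet_eval_eq (U := U) t x
  have hπ : π x ≠ ∞ := by rw [← h.measure_eval_eq t x]; exact measure_ne_top _ _
  set ρ := μ.restrict {ω | ω t = x} with hρ
  have step1 : ∀ (m : ℕ) (a : ℕ → U) (F : Set (ℕ → U)), MeasurableSet F →
      π x * ρ (pastAt t ⁻¹' {ω | ∀ i ≤ m, ω i = a i} ∩ futureAt t ⁻¹' F) =
        ρ (pastAt t ⁻¹' {ω | ∀ i ≤ m, ω i = a i}) * ρ (futureAt t ⁻¹' F) := by
    intro m a F hF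
    have hE := hp (measurableSet_cylinder_nat m a)
    set E := pastAt t ⁻¹' {ω | ∀ i ≤ m, ω i = a i} with hEdef
    have key : π x • (ρ.restrict E).map (futureAt t) = ρ E • ρ.map (futureAt t) := by
      have : IsFiniteMeasure (π x • (ρ.restrict E).map (futureAt t)) := Measure.smul_finite _ hπ
      refine ext_of_cylinders_nat fun n b => ?_
      have hb := measurableSet_cylinder_nat n b
      simp only [Measure.smul_apply, smul_eq_mul]
      rw [Measure.map_apply hq hb, Measure.map_apply hq hb, Measure.restrict_apply (hq hb), hρ,
        Measure.restrict_apply ((hq hb).inter hE), Measure.restrict_apply hE,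
        Measure.restrict_apply (hq hb)]
      have := h.cylinder_mul t x m n a b
      simpa only [Set.inter_comm, Set.inter_left_comm, hEdef, Set.preimage_ofPred_eq] using this
    have := congrArg (fun κ : Measure (ℕ → U) => κ F) key
    simp only [Measure.smul_apply, smul_eq_mul] at this
    rwa [Measure.map_apply hq hF, Measure.map_apply hq hF, Measure.restrict_apply (hq hF),
      Set.inter_comm] at this
  refine Measure.prod_eq fun E F hE hF => ?_
  have key : π x • (ρ.restrict (futureAt t ⁻¹' F)).map (pastAt t) =
      ρ (futureAt t ⁻¹' F) • ρ.map (pastAt t) := by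
    have : IsFiniteMeasure (π x • (ρ.restrict (futureAt t ⁻¹' F)).map (pastAt t)) :=
      Measure.smul_finite _ hπ
    refine ext_of_cylinders_nat fun m a => ?_
    have ha := measurableSet_cylinder_nat m a
    simp only [Measure.smul_apply, smul_eq_mul]
    rw [Measure.map_apply hp ha, Measure.map_apply hp ha, Measure.restrict_apply (hp ha),
      step1 m a F hF, mul_comm]
  have := congrArg (fun κ : Measure (ℕ → U) => κ E) key
  simp only [Measure.smul_apply, smul_eq_mul] at this
  rw [Measure.map_apply hp hE, Measure.map_apply hp hE, Measure.restrict_apply (hp hE)] at this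
  rw [Measure.smul_apply, smul_eq_mul, Measure.map_apply (hp.prodMk hq) (hE.prod hF),
    Measure.map_apply hp hE, Measure.map_apply hq hF, mul_comm (ρ _), ← this]
  rfl

end MarkovChain

/-- The map on paths induced by a map of state spaces. -/
def pathMap {ι A C : Type*} (f : A → C) (ω : ι → A) : ι → C := fun n => f (ω n)

lemma measurable_pathMap {ι A C : Type*} [MeasurableSpace A] [MeasurableSpace C] {f : A → C}
    (hf : Measurable f) : Measurable (pathMap f : (ι → A) → ι → C) := by
  unfold pathMap; fun_prop

/-- Given the image process, the past and the future of a Markov chain at a given state are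
conditionally independent, with conditional probabilities depending only on the past and the future
of the image process respectively. -/
lemma exists_isFactorDensity_past_future {A C : Type*} [Countable A] [Countable C]
    [MeasurableSpace A] [MeasurableSingletonClass A]
    [MeasurableSpace C] [MeasurableSingletonClass C]
    {πX : A → ℝ≥0∞} {PX : A → A → ℝ≥0∞} {μX : Measure (ℤ → A)}
    {πZ : C → ℝ≥0∞} {PZ : C → C → ℝ≥0∞} {μZ : Measure (ℤ → C)} {f : A → C}
    (hX : IsStatMarkovChainZ πX PX μX) (hZ : IsStatMarkovChainZ πZ PZ μZ)
    (hfX : μX.map (pathMap f) = μZ) (t : ℤ) (x : A) (hx : πX x ≠ 0) :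
    ∃ d d' : Set (ℕ → A) → (ℕ → C) → ℝ≥0∞, (∀ E, Measurable (d E)) ∧ (∀ E, Measurable (d' E)) ∧
      ∀ E F, MeasurableSet E → MeasurableSet F →
        IsFactorDensity μX (pathMap f) ({ω | ω t = x} ∩ (pastAt t ⁻¹' E ∩ futureAt t ⁻¹' F))
          ({z | z t = f x}.indicator fun z =>
            πZ (f x) / πX x * (d E (pastAt t z) * d' F (futureAt t z))) := by
  have := hX.1
  have := hZ.1
  have hπX : πX x ≠ ∞ := by rw [← hX.measure_eval_eq t x]; exact measure_ne_top _ _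
  have hf : Measurable f := measurable_of_countable f
  have hF := measurable_pathMap (ι := ℤ) hf
  have hF' := measurable_pathMap (ι := ℕ) hf
  have hxm := measurableSet_eval_eq (U := A) t x
  have hzm := measurableSet_eval_eq (U := C) t (f x)
  have hpq : Measurable fun z : ℤ → C => (pastAt t z, futureAt t z) :=
    (measurable_pastAt t).prodMk (measurable_futureAt t)
  have hpqX : Measurable fun z : ℤ → A => (pastAt t z, futureAt t z) :=
    (measurable_pastAt t).prodMk (measurable_futureAt t)
  set ρX := μX.restrict {ω | ω t = x}
  set ρZ := μZ.restrict {z | z t = f x}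
  have hle : ρX.map (pathMap f) ≤ ρZ := by
    refine Measure.le_iff.2 fun D hD => ?_
    rw [Measure.map_apply hF hD, Measure.restrict_apply (hF hD), Measure.restrict_apply hD, ← hfX,
      Measure.map_apply hF (hD.inter hzm)]
    refine measure_mono fun ω hω => ⟨hω.1, ?_⟩
    have : ω t = x := hω.2
    simp [pathMap, this]
  have hacp : ∀ E, ((ρX.map (pastAt t)).restrict E).map (pathMap f) ≪ ρZ.map (pastAt t) := by
    intro E
    refine (Measure.restrict_le_self.absolutelyContinuous.map hF').trans ?_
    rw [Measure.map_map hF' (measurable_pastAt t)]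
    have := hle.absolutelyContinuous.map (measurable_pastAt t)
    rwa [Measure.map_map (measurable_pastAt t) hF] at this
  have hacf : ∀ E, ((ρX.map (futureAt t)).restrict E).map (pathMap f) ≪ ρZ.map (futureAt t) := by
    intro E
    refine (Measure.restrict_le_self.absolutelyContinuous.map hF').trans ?_
    rw [Measure.map_map hF' (measurable_futureAt t)]
    have := hle.absolutelyContinuous.map (measurable_futureAt t)
    rwa [Measure.map_map (measurable_futureAt t) hF] at this
  refine ⟨fun E => (((ρX.map (pastAt t)).restrict E).map (pathMap f)).rnDeriv (ρZ.map (pastAt t)),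
    fun E => (((ρX.map (futureAt t)).restrict E).map (pathMap f)).rnDeriv (ρZ.map (futureAt t)),
    fun E => Measure.measurable_rnDeriv _ _, fun E => Measure.measurable_rnDeriv _ _,
    fun E F hE hFm => ?_⟩
  have hd := Measure.withDensity_rnDeriv_eq _ _ (hacp E)
  have hd' := Measure.withDensity_rnDeriv_eq _ _ (hacf F)
  have hdm := Measure.measurable_rnDeriv (((ρX.map (pastAt t)).restrict E).map (pathMap f))
    (ρZ.map (pastAt t))
  have hdm' := Measure.measurable_rnDeriv (((ρX.map (futureAt t)).restrict F).map (pathMap f))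
    (ρZ.map (futureAt t))
  set d := (((ρX.map (pastAt t)).restrict E).map (pathMap f)).rnDeriv (ρZ.map (pastAt t))
  set d' := (((ρX.map (futureAt t)).restrict F).map (pathMap f)).rnDeriv (ρZ.map (futureAt t))
  have hprod : (πZ (f x) • ρZ.map (fun z => (pastAt t z, futureAt t z))).withDensity
        (fun w => d w.1 * d' w.2) =
      ((πX x • ρX.map (fun z => (pastAt t z, futureAt t z))).restrict (E ×ˢ F)).map
        (Prod.map (pathMap f) (pathMap f)) := by
    rw [← hZ.past_prod_future t (f x), ← hX.past_prod_future t x, ← prod_withDensity hdm hdm', hd,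
      hd', ← Measure.prod_restrict, Measure.map_prod_map _ _ hF' hF']
  have hdd : Measurable fun z => d (pastAt t z) * d' (futureAt t z) :=
    (hdm.comp (measurable_pastAt t)).mul (hdm'.comp (measurable_futureAt t))
  have hdw : Measurable fun w : (ℕ → C) × (ℕ → C) => d w.1 * d' w.2 :=
    (hdm.comp measurable_fst).mul (hdm'.comp measurable_snd)
  refine .of_setLIntegral_eq hF ((hdd.const_mul _).indicator hzm) fun D hD => ?_
  rw [hfX, setLIntegral_indicator hzm, lintegral_const_mul _ hdd, Set.inter_comm,
    ← Measure.restrict_restrict hD]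
  obtain ⟨D', hD', rfl⟩ : ∃ D' : Set ((ℕ → C) × (ℕ → C)), MeasurableSet D' ∧
      (fun z => (pastAt t z, futureAt t z)) ⁻¹' D' = D := by
    let r : (ℕ → C) × (ℕ → C) → ℤ → C := fun w s =>
      if t ≤ s then w.2 (s - t).toNat else w.1 (t - s).toNat
    have hr : Measurable r := by
      refine measurable_pi_lambda _ fun s => ?_
      by_cases hs : t ≤ s
      · simp only [r, if_pos hs]; fun_prop
      · simp only [r, if_neg hs]; fun_prop
    refine ⟨r ⁻¹' D, hr hD, ?_⟩
    have : ∀ z : ℤ → C, r (pastAt t z, futureAt t z) = z := by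
      intro z
      funext s
      by_cases hs : t ≤ s
      · simp only [r, if_pos hs, futureAt]; congr 1; omega
      · simp only [r, if_neg hs, pastAt]; congr 1; omega
    ext z
    simp [this]
  have happ := congrArg (fun κ => κ D') hprod
  have hPM : Measurable (Prod.map (pathMap f) (pathMap f) : (ℕ → A) × (ℕ → A) → _) :=
    hF'.prodMap hF'
  rw [withDensity_smul_measure, Measure.smul_apply, withDensity_apply _ hD',
    setLIntegral_map hD' hdw hpq,
    Measure.map_apply hPM hD', Measure.restrict_apply (hPM hD'), Measure.smul_apply,
    Measure.map_apply hpqX ((hPM hD').inter (hE.prod hFm)),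
    Measure.restrict_apply (hpqX ((hPM hD').inter (hE.prod hFm)))] at happ
  simp only [smul_eq_mul] at happ
  rw [← ENNReal.mul_div_right_comm, happ, mul_comm, ENNReal.mul_div_cancel_right hx hπX]
  congr 1
  ext ω
  simp only [Set.mem_inter_iff, Set.mem_preimage, Set.mem_prod, Prod.map, Set.mem_ofPred_eq]
  exact and_right_comm.trans and_assoc

lemma tsum_measure_eval_eq {ι U : Type*} [Countable U] [MeasurableSpace U]
    [MeasurableSingletonClass U] (μ : Measure (ι → U)) (t : ι) :
    ∑' u, μ {ω | ω t = u} = μ Set.univ := by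
  have h := tsum_measure_preimage_singleton (μ := μ) (Set.countable_univ (α := U))
    (f := fun ω : ι → U => ω t) fun u _ => measurableSet_eval_eq t u
  rwa [tsum_univ (fun u : U => μ ((fun ω : ι → U => ω t) ⁻¹' {u}))] at h

/-- A measure on path space whose cylinder probabilities are shift-invariant and satisfy the
one-step Markov property is the law of a stationary Markov chain. -/
lemma exists_isStatMarkovChainZ {U : Type*} [Countable U] [MeasurableSpace U]
    [MeasurableSingletonClass U] (μ : Measure (ℤ → U)) [IsProbabilityMeasure μ]
    (hshift : ∀ (t : ℤ) (k : ℕ) (a : ℕ → U), μ {ω | ∀ i ≤ k, ω (t + (i : ℤ)) = a i} =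
      μ {ω | ∀ i ≤ k, ω (0 + (i : ℤ)) = a i})
    (hmarkov : ∀ (t : ℤ) (k : ℕ) (a : ℕ → U),
      μ {ω | ∀ i ≤ k + 1, ω (t + (i : ℤ)) = a i} * μ {ω | ω (t + k) = a k} =
        μ {ω | ∀ i ≤ k, ω (t + (i : ℤ)) = a i} *
          μ {ω | ω (t + k) = a k ∧ ω (t + k + 1) = a (k + 1)}) :
    ∃ (π : U → ℝ≥0∞) (P : U → U → ℝ≥0∞), IsStatMarkovChainZ π P μ := by
  have hone : ∀ t u, μ {ω | ω t = u} = μ {ω | ω 0 = u} := by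
    intro t u
    simpa using hshift t 0 (fun _ => u)
  have htwo : ∀ t u v, μ {ω | ω t = u ∧ ω (t + 1) = v} = μ {ω | ω 0 = u ∧ ω 1 = v} := by
    intro t u v
    have h := hshift t 1 (fun i => if i = 0 then u else v)
    have aux : ∀ s : ℤ, {ω : ℤ → U | ∀ i ≤ 1, ω (s + (i : ℕ)) = if i = 0 then u else v} =
        {ω | ω s = u ∧ ω (s + 1) = v} := by
      intro s
      ext ω
      simp only [Set.mem_ofPred_eq]
      refine ⟨fun H => ⟨by simpa using H 0 (by omega), by simpa using H 1 le_rfl⟩, ?_⟩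
      rintro ⟨h0, h1⟩ i hi
      interval_cases i
      · simpa using h0
      · simpa using h1
    rw [aux, aux] at h
    simpa using h
  refine ⟨fun u => μ {ω | ω 0 = u}, fun u v => if μ {ω | ω 0 = u} = 0 then (if v = u then 1 else 0)
    else μ {ω | ω 0 = u ∧ ω 1 = v} / μ {ω | ω 0 = u}, inferInstance, ?_, ?_, ?_⟩
  · exact (tsum_measure_eval_eq μ 0).trans measure_univ
  · intro u
    simp only
    split_ifs with hu
    · simp
    · have h := tsum_measure_eval_eq (μ.restrict {ω | ω 0 = u}) 1
      simp only [Measure.restrict_apply (measurableSet_eval_eq _ _), Measure.restrict_apply_univ]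
        at h
      simp only [div_eq_mul_inv, ENNReal.tsum_mul_right]
      rw [← ENNReal.mul_inv_cancel hu (measure_ne_top _ _), ← h]
      congr 1
      refine tsum_congr fun v => ?_
      congr 1
      ext ω
      exact and_comm
  · intro t k
    induction k with
    | zero => intro a; simp [hone]
    | succ k ih =>
      intro a
      rw [Finset.prod_range_succ, ← mul_assoc, ← ih a]
      have h := hmarkov t k a
      rw [hone, htwo] at h
      have hle1 : μ {ω | ∀ i ≤ k + 1, ω (t + (i : ℤ)) = a i} ≤ μ {ω | ω 0 = a k} := by
        rw [← hone (t + k)]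
        exact measure_mono fun ω hω => hω k (by omega)
      have hle2 : μ {ω | ∀ i ≤ k, ω (t + (i : ℤ)) = a i} ≤ μ {ω | ω 0 = a k} := by
        rw [← hone (t + k)]
        exact measure_mono fun ω hω => hω k le_rfl
      by_cases h0 : μ {ω | ω 0 = a k} = 0
      · rw [h0, nonpos_iff_eq_zero] at hle1 hle2
        rw [hle1, hle2, zero_mul]
      · simp only [if_neg h0]
        rw [← mul_div_assoc, ← h,
          ENNReal.mul_div_cancel_right h0 (measure_ne_top _ _)]

/-- The defining property of the relatively independent coupling of `μ₁` and `μ₂` over their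
common factor. -/
def IsRelIndepCoupling {Ω₁ Ω₂ Ω' : Type*} [MeasurableSpace Ω₁] [MeasurableSpace Ω₂]
    [MeasurableSpace Ω'] (ν : Measure (Ω₁ × Ω₂)) (μ₁ : Measure Ω₁) (μ₂ : Measure Ω₂)
    (F : Ω₁ → Ω') (G : Ω₂ → Ω') : Prop :=
  ∀ S T φ ψ, MeasurableSet S → MeasurableSet T → IsFactorDensity μ₁ F S φ →
    IsFactorDensity μ₂ G T ψ → ν (S ×ˢ T) = ∫⁻ z, φ z * ψ z ∂(μ₁.map F)

section RelIndep

variable {Ω₁ Ω₂ Ω' : Type*} [MeasurableSpace Ω₁] [MeasurableSpace Ω₂] [MeasurableSpace Ω']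
  {ν : Measure (Ω₁ × Ω₂)} {μ₁ : Measure Ω₁} {μ₂ : Measure Ω₂} {F : Ω₁ → Ω'} {G : Ω₂ → Ω'}

lemma exists_isFactorDensity {Ω : Type*} [MeasurableSpace Ω] {μ : Measure Ω} {F : Ω → Ω'}
    [IsProbabilityMeasure μ] [StandardBorelSpace Ω] (hF : Measurable F) {S : Set Ω}
    (hS : MeasurableSet S) : ∃ φ, IsFactorDensity μ F S φ ∧ ∀ z, φ z ≠ ∞ := by
  have := nonempty_of_isProbabilityMeasure μ
  exact ⟨_, isFactorDensity_condDistrib hF hS, fun z => measure_ne_top _ _⟩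

lemma IsRelIndepCoupling.map_fst [StandardBorelSpace Ω₁] [IsProbabilityMeasure μ₁]
    (h : IsRelIndepCoupling ν μ₁ μ₂ F G) (hF : Measurable F) : ν.map Prod.fst = μ₁ := by
  refine Measure.ext fun S hS => ?_
  obtain ⟨φ, hφ, -⟩ := exists_isFactorDensity (μ := μ₁) hF hS
  rw [Measure.map_apply measurable_fst hS, ← Set.prod_univ, h S _ φ 1 hS .univ hφ .univ]
  simpa using hφ.setLIntegral_eq hF .univ

lemma IsRelIndepCoupling.map_snd [StandardBorelSpace Ω₂] [IsProbabilityMeasure μ₂]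
    (h : IsRelIndepCoupling ν μ₁ μ₂ F G) (hG : Measurable G) (hFG : μ₁.map F = μ₂.map G) :
    ν.map Prod.snd = μ₂ := by
  refine Measure.ext fun S hS => ?_
  obtain ⟨φ, hφ, -⟩ := exists_isFactorDensity (μ := μ₂) hG hS
  rw [Measure.map_apply measurable_snd hS, ← Set.univ_prod, h _ S 1 φ .univ hS .univ hφ, hFG]
  simpa using hφ.setLIntegral_eq hG .univ

lemma IsRelIndepCoupling.preimage_prod_preimage (h : IsRelIndepCoupling ν μ₁ μ₂ F G)
    (hF : Measurable F) (hG : Measurable G) {D E : Set Ω'} (hD : MeasurableSet D)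
    (hE : MeasurableSet E) (hDE : Disjoint D E) : ν ((F ⁻¹' D) ×ˢ (G ⁻¹' E)) = 0 := by
  rw [h _ _ _ _ (hF hD) (hG hE) (.preimage hF hD) (.preimage hG hE)]
  have : ∀ z, D.indicator (1 : Ω' → ℝ≥0∞) z * E.indicator 1 z = 0 := by
    intro z
    by_cases hz : z ∈ D
    · simp [Set.disjoint_left.1 hDE hz]
    · simp [hz]
  simp [this]

lemma IsFactorDensity.comp {Ω : Type*} [MeasurableSpace Ω] {μ : Measure Ω} {F : Ω → Ω'}
    {S : Set Ω} {φ : Ω' → ℝ≥0∞} (h : IsFactorDensity μ F S φ) (hF : Measurable F) {σ : Ω → Ω}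
    {σ' τ' : Ω' → Ω'} (hσ : Measurable σ) (hσ' : Measurable σ') (hτ' : Measurable τ')
    (hτσ : ∀ z, τ' (σ' z) = z) (hμ : μ.map σ = μ) (hFσ : ∀ ω, F (σ ω) = σ' (F ω))
    (hS : MeasurableSet S) :
    IsFactorDensity μ F (σ ⁻¹' S) (φ ∘ σ') := by
  have hmap : (μ.map F).map σ' = μ.map F := by
    rw [Measure.map_map hσ' hF, ← (funext hFσ : F ∘ σ = σ' ∘ F), ← Measure.map_map hF hσ, hμ]
  refine .of_setLIntegral_eq hF (h.1.comp hσ') fun D hD => ?_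
  have hD' : σ' ⁻¹' (τ' ⁻¹' D) = D := by ext z; simp [hτσ]
  have h1 := setLIntegral_map (μ := μ.map F) (hτ' hD) h.1 hσ'
  rw [hD'] at h1
  simp only [Function.comp_apply]
  rw [← h1, hmap, h.setLIntegral_eq hF (hτ' hD), ← hμ,
    Measure.map_apply hσ ((hF (hτ' hD)).inter hS), hμ]
  congr 1
  ext ω
  simp [hFσ, hτσ]

lemma IsRelIndepCoupling.preimage_prod [StandardBorelSpace Ω₁] [StandardBorelSpace Ω₂]
    [IsProbabilityMeasure μ₁] [IsProbabilityMeasure μ₂]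
    (h : IsRelIndepCoupling ν μ₁ μ₂ F G) (hF : Measurable F) (hG : Measurable G)
    {σ₁ : Ω₁ → Ω₁} {σ₂ : Ω₂ → Ω₂} {σ' τ' : Ω' → Ω'} (hσ₁ : Measurable σ₁) (hσ₂ : Measurable σ₂)
    (hσ' : Measurable σ') (hτ' : Measurable τ') (hτσ : ∀ z, τ' (σ' z) = z)
    (hμ₁ : μ₁.map σ₁ = μ₁) (hμ₂ : μ₂.map σ₂ = μ₂) (hFσ : ∀ ω, F (σ₁ ω) = σ' (F ω))
    (hGσ : ∀ ω, G (σ₂ ω) = σ' (G ω)) {S : Set Ω₁} {T : Set Ω₂} (hS : MeasurableSet S)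
    (hT : MeasurableSet T) : ν ((σ₁ ⁻¹' S) ×ˢ (σ₂ ⁻¹' T)) = ν (S ×ˢ T) := by
  obtain ⟨φ, hφ, -⟩ := exists_isFactorDensity (μ := μ₁) hF hS
  obtain ⟨ψ, hψ, -⟩ := exists_isFactorDensity (μ := μ₂) hG hT
  have hmap : (μ₁.map F).map σ' = μ₁.map F := by
    rw [Measure.map_map hσ' hF, ← (funext hFσ : F ∘ σ₁ = σ' ∘ F), ← Measure.map_map hF hσ₁, hμ₁]
  rw [h _ _ _ _ hS hT hφ hψ, h _ _ _ _ (hσ₁ hS) (hσ₂ hT)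
    (hφ.comp hF hσ₁ hσ' hτ' hτσ hμ₁ hFσ hS) (hψ.comp hG hσ₂ hσ' hτ' hτσ hμ₂ hGσ hT)]
  have hm : Measurable fun z => φ z * ψ z := hφ.1.mul hψ.1
  conv_rhs => rw [← hmap, lintegral_map hm hσ']
  rfl

end RelIndep

lemma IsFactorDensity.condExp_indic {Ω γ : Type*} [MeasurableSpace Ω] [MeasurableSpace γ]
    {μ : Measure Ω} [IsProbabilityMeasure μ] {Z : Ω → γ} {S : Set Ω} {φ : γ → ℝ≥0∞}
    (h : IsFactorDensity μ Z S φ) (hZ : Measurable Z) (hS : MeasurableSet S)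
    (hφ : ∀ z, φ z ≠ ∞) :
    μ[indic S|MeasurableSpace.comap Z inferInstance] =ᵐ[μ] fun ω => (φ (Z ω)).toReal := by
  have hm : MeasurableSpace.comap Z inferInstance ≤ (inferInstance : MeasurableSpace Ω) :=
    hZ.comap_le
  have hφZ : Measurable fun ω => φ (Z ω) := h.1.comp hZ
  have hset : ∀ D, MeasurableSet D → ∫⁻ ω in Z ⁻¹' D, φ (Z ω) ∂μ = μ (Z ⁻¹' D ∩ S) := by
    intro D hD
    rw [← h.setLIntegral_eq hZ hD, setLIntegral_map hD h.1 hZ]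
  have hfin : ∫⁻ ω, φ (Z ω) ∂μ ≠ ∞ := by
    have := hset _ .univ
    simp only [Set.preimage_univ, Measure.restrict_univ] at this
    rw [this]
    exact measure_ne_top _ _
  have hint : Integrable (fun ω => (φ (Z ω)).toReal) μ :=
    integrable_toReal_of_lintegral_ne_top hφZ.aemeasurable hfin
  symm
  refine ae_eq_condExp_of_forall_setIntegral_eq hm ?_ (fun s _ _ => hint.integrableOn) ?_ ?_
  · exact (integrable_const (1 : ℝ)).indicator hS
  · rintro _ ⟨D, hD, rfl⟩ -
    rw [integral_toReal hφZ.aemeasurable (ae_of_all _ fun ω => (hφ _).lt_top), hset D hD]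
    unfold indic
    rw [integral_indicator hS, Measure.restrict_restrict hS, integral_const]
    simp [Measure.real, Set.inter_comm]
  · exact ((h.1.ennreal_toReal.comp (comap_measurable Z)).stronglyMeasurable).aestronglyMeasurable

lemma cylinder_eq_past {U : Type*} (t : ℤ) (k : ℕ) (a : ℕ → U) :
    {ω : ℤ → U | ∀ i ≤ k, ω (t + (i : ℤ)) = a i} =
      {ω | ω (t + k) = a k} ∩ (pastAt (t + k) ⁻¹' {ω | ∀ i ≤ k, ω i = a (k - i)}) := by
  ext ω
  simp only [Set.mem_inter_iff, Set.mem_ofPred_eq, Set.mem_preimage, pastAt]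
  refine ⟨fun H => ⟨H k le_rfl, fun i hi => ?_⟩, fun H i hi => ?_⟩
  · rw [← H (k - i) (by omega)]
    congr 1
    omega
  · have := H.2 (k - i) (by omega)
    rw [show k - (k - i) = i by omega] at this
    rw [← this]
    congr 1
    omega

lemma cylinder_succ_eq {U : Type*} (t : ℤ) (k : ℕ) (a : ℕ → U) :
    {ω : ℤ → U | ∀ i ≤ k + 1, ω (t + (i : ℤ)) = a i} =
      {ω | ω (t + k) = a k} ∩ (pastAt (t + k) ⁻¹' {ω | ∀ i ≤ k, ω i = a (k - i)} ∩
        futureAt (t + k) ⁻¹' {ω | ω 1 = a (k + 1)}) := by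
  rw [← Set.inter_assoc, ← cylinder_eq_past]
  ext ω
  simp only [Set.mem_inter_iff, Set.mem_ofPred_eq, Set.mem_preimage, futureAt, Nat.cast_one,
    Nat.le_succ_iff, or_imp, forall_and, forall_eq, Nat.succ_eq_add_one, Nat.cast_add, add_assoc]

lemma measurableSet_past_future {U : Type*} [MeasurableSpace U] [MeasurableSingletonClass U]
    (t : ℤ) (u : U) {E F : Set (ℕ → U)} (hE : MeasurableSet E) (hF : MeasurableSet F) :
    MeasurableSet ({ω : ℤ → U | ω t = u} ∩ (pastAt t ⁻¹' E ∩ futureAt t ⁻¹' F)) :=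
  (measurableSet_eval_eq t u).inter ((measurable_pastAt t hE).inter (measurable_futureAt t hF))

/-- A pair of paths, seen as a path of pairs. -/
def zipPath {A B : Type*} (w : (ℤ → A) × (ℤ → B)) : ℤ → A × B := fun n => (w.1 n, w.2 n)

lemma measurable_zipPath {A B : Type*} [MeasurableSpace A] [MeasurableSpace B] :
    Measurable (zipPath : (ℤ → A) × (ℤ → B) → ℤ → A × B) := by
  unfold zipPath; fun_prop

section Coupling

variable {A B C : Type*} [Countable A] [Countable B] [Countable C]
  [MeasurableSpace A] [MeasurableSingletonClass A]
  [MeasurableSpace B] [MeasurableSingletonClass B]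
  [MeasurableSpace C] [MeasurableSingletonClass C]
  {πX : A → ℝ≥0∞} {PX : A → A → ℝ≥0∞} {μX : Measure (ℤ → A)}
  {πY : B → ℝ≥0∞} {PY : B → B → ℝ≥0∞} {μY : Measure (ℤ → B)}
  {πZ : C → ℝ≥0∞} {PZ : C → C → ℝ≥0∞} {μZ : Measure (ℤ → C)}
  {f : A → C} {g : B → C} {ν : Measure ((ℤ → A) × (ℤ → B))}

/-- Under the relatively independent coupling of two Markov chains over a common Markov factor,
past and future are independent given the present state of the pair. -/
lemma IsRelIndepCoupling.exists_past_future_factorization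
    (hν : IsRelIndepCoupling ν μX μY (pathMap f) (pathMap g))
    (hX : IsStatMarkovChainZ πX PX μX) (hY : IsStatMarkovChainZ πY PY μY)
    (hZ : IsStatMarkovChainZ πZ PZ μZ)
    (hfX : μX.map (pathMap f) = μZ) (hgY : μY.map (pathMap g) = μZ) (t : ℤ) (x : A) (y : B) :
    ∃ Φ Ψ : Set (ℕ → A) → Set (ℕ → B) → ℝ≥0∞, ∀ E F E' F', MeasurableSet E → MeasurableSet F →
      MeasurableSet E' → MeasurableSet F' →
      ν (({ω | ω t = x} ∩ (pastAt t ⁻¹' E ∩ futureAt t ⁻¹' F)) ×ˢ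
        ({ω | ω t = y} ∩ (pastAt t ⁻¹' E' ∩ futureAt t ⁻¹' F'))) = Φ E E' * Ψ F F' := by
  have := hX.1
  have := hY.1
  have := hZ.1
  have hf := measurable_pathMap (ι := ℤ) (measurable_of_countable f)
  have hg := measurable_pathMap (ι := ℤ) (measurable_of_countable g)
  have hnull : ν ({ω | ω t = x} ×ˢ {ω | ω t = y}) = 0 → ∃ Φ Ψ : Set (ℕ → A) → Set (ℕ → B) → ℝ≥0∞,
      ∀ E F E' F', MeasurableSet E → MeasurableSet F → MeasurableSet E' → MeasurableSet F' →
      ν (({ω | ω t = x} ∩ (pastAt t ⁻¹' E ∩ futureAt t ⁻¹' F)) ×ˢ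
        ({ω | ω t = y} ∩ (pastAt t ⁻¹' E' ∩ futureAt t ⁻¹' F'))) = Φ E E' * Ψ F F' :=
    fun h0 => ⟨0, 0, fun E F E' F' _ _ _ _ => by
      simpa using measure_mono_null
        (Set.prod_mono Set.inter_subset_left Set.inter_subset_left) h0⟩
  by_cases hx : πX x = 0
  · refine hnull (measure_mono_null (Set.prod_mono_right (Set.subset_univ _)) ?_)
    rw [Set.prod_univ, ← Measure.map_apply measurable_fst (measurableSet_eval_eq t x),
      hν.map_fst hf, hX.measure_eval_eq, hx]
  by_cases hy : πY y = 0
  · refine hnull (measure_mono_null (Set.prod_mono_left (Set.subset_univ _)) ?_)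
    rw [Set.univ_prod, ← Measure.map_apply measurable_snd (measurableSet_eval_eq t y),
      hν.map_snd hg (hfX.trans hgY.symm), hY.measure_eval_eq, hy]
  by_cases hxy : g y = f x
  swap
  · refine hnull (measure_mono_null (Set.prod_mono (fun ω hω => ?_) (fun ω hω => ?_))
      (hν.preimage_prod_preimage hf hg (measurableSet_eval_eq t (f x))
        (measurableSet_eval_eq t (g y))
        (Set.disjoint_left.2 fun z hz hz' => hxy (hz'.symm.trans hz))))
    · exact congrArg f hω
    · exact congrArg g hω
  obtain ⟨d, d', hd, hd', hdd⟩ := exists_isFactorDensity_past_future hX hZ hfX t x hx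
  obtain ⟨e, e', he, he', hee⟩ := exists_isFactorDensity_past_future hY hZ hgY t y hy
  rw [hxy] at hee
  have hz : πZ (f x) ≠ 0 := by
    refine (lt_of_lt_of_le (pos_iff_ne_zero.2 hx) ?_).ne'
    rw [← hX.measure_eval_eq t x, ← hZ.measure_eval_eq t, ← hfX,
      Measure.map_apply hf (measurableSet_eval_eq t _)]
    exact measure_mono fun ω hω => congrArg f hω
  have hz' : πZ (f x) ≠ ∞ := by rw [← hZ.measure_eval_eq t]; exact measure_ne_top _ _
  have hp := measurable_pastAt (U := C) t
  have hq := measurable_futureAt (U := C) t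
  set ρ := μZ.restrict {z | z t = f x} with hρ
  refine ⟨fun E E' => (πZ (f x))⁻¹ * (πZ (f x) / πX x * (πZ (f x) / πY y)) *
      ∫⁻ z, d E z * e E' z ∂ρ.map (pastAt t),
    fun F F' => ∫⁻ z, d' F z * e' F' z ∂ρ.map (futureAt t), fun E F E' F' hE hF hE' hF' => ?_⟩
  have hm1 : Measurable fun z => d E z * e E' z := (hd E).mul (he E')
  have hm2 : Measurable fun z => d' F z * e' F' z := (hd' F).mul (he' F')
  have hm : Measurable fun w : (ℕ → C) × (ℕ → C) =>
      (d E w.1 * e E' w.1) * (d' F w.2 * e' F' w.2) :=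
    (hm1.comp measurable_fst).mul (hm2.comp measurable_snd)
  have hpqm : Measurable fun z : ℤ → C => (pastAt t z, futureAt t z) := hp.prodMk hq
  have hprod := lintegral_prod_mul (μ := ρ.map (pastAt t)) (ν := ρ.map (futureAt t))
    hm1.aemeasurable hm2.aemeasurable
  rw [hρ, hZ.past_prod_future, lintegral_smul_measure, lintegral_map hm hpqm, ← hρ] at hprod
  rw [hν _ _ _ _ (measurableSet_past_future t x hE hF) (measurableSet_past_future t y hE' hF')
    (hdd E F hE hF) (hee E' F' hE' hF'), hfX, mul_assoc, ← hprod]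
  simp_rw [← Set.indicator_mul]
  rw [lintegral_indicator (measurableSet_eval_eq t _), ← hρ, smul_eq_mul]
  have hcomm : ∀ z, πZ (f x) / πX x * (d E (pastAt t z) * d' F (futureAt t z)) *
      (πZ (f x) / πY y * (e E' (pastAt t z) * e' F' (futureAt t z))) =
      (πZ (f x) / πX x * (πZ (f x) / πY y)) * ((d E (pastAt t z) * e E' (pastAt t z)) *
        (d' F (futureAt t z) * e' F' (futureAt t z))) := fun z => by ring
  simp_rw [hcomm]
  have hm3 : Measurable fun z : ℤ → C => (d E (pastAt t z) * e E' (pastAt t z)) *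
      (d' F (futureAt t z) * e' F' (futureAt t z)) := hm.comp hpqm
  rw [lintegral_const_mul _ hm3, mul_mul_mul_comm, ENNReal.inv_mul_cancel hz hz', one_mul]

lemma IsRelIndepCoupling.cylinder_mul
    (hν : IsRelIndepCoupling ν μX μY (pathMap f) (pathMap g))
    (hX : IsStatMarkovChainZ πX PX μX) (hY : IsStatMarkovChainZ πY PY μY)
    (hZ : IsStatMarkovChainZ πZ PZ μZ)
    (hfX : μX.map (pathMap f) = μZ) (hgY : μY.map (pathMap g) = μZ) (t : ℤ) (k : ℕ)
    (a : ℕ → A) (b : ℕ → B) :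
    ν ({ω | ∀ i ≤ k + 1, ω (t + (i : ℤ)) = a i} ×ˢ {ω | ∀ i ≤ k + 1, ω (t + (i : ℤ)) = b i}) *
        ν ({ω | ω (t + k) = a k} ×ˢ {ω | ω (t + k) = b k}) =
      ν ({ω | ∀ i ≤ k, ω (t + (i : ℤ)) = a i} ×ˢ {ω | ∀ i ≤ k, ω (t + (i : ℤ)) = b i}) *
        ν ({ω | ω (t + k) = a k ∧ ω (t + k + 1) = a (k + 1)} ×ˢ
          {ω | ω (t + k) = b k ∧ ω (t + k + 1) = b (k + 1)}) := by
  obtain ⟨Φ, Ψ, h⟩ :=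
    hν.exists_past_future_factorization hX hY hZ hfX hgY (t + k) (a k) (b k)
  have h1 := h _ _ _ _ (measurableSet_cylinder_nat k fun i => a (k - i))
    (measurableSet_eval_eq 1 (a (k + 1))) (measurableSet_cylinder_nat k fun i => b (k - i))
    (measurableSet_eval_eq 1 (b (k + 1)))
  have h2 := h _ _ _ _ .univ .univ .univ .univ
  have h3 := h _ _ _ _ (measurableSet_cylinder_nat k fun i => a (k - i)) .univ
    (measurableSet_cylinder_nat k fun i => b (k - i)) .univ
  have h4 := h _ _ _ _ .univ (measurableSet_eval_eq 1 (a (k + 1))) .univ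
    (measurableSet_eval_eq 1 (b (k + 1)))
  rw [← cylinder_succ_eq, ← cylinder_succ_eq] at h1
  simp only [Set.preimage_univ, Set.inter_univ, Set.univ_inter] at h2 h3 h4
  rw [← cylinder_eq_past, ← cylinder_eq_past] at h3
  rw [h1, h2, h3]
  refine Eq.trans ?_ (congrArg _ h4.symm)
  ring

end Coupling

lemma IsRelIndepCoupling.cylinder_shift {A B C : Type*} [Countable A] [Countable B]
    [MeasurableSpace A] [MeasurableSingletonClass A] [MeasurableSpace B]
    [MeasurableSingletonClass B] [MeasurableSpace C] {πX : A → ℝ≥0∞} {PX : A → A → ℝ≥0∞}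
    {μX : Measure (ℤ → A)} {πY : B → ℝ≥0∞} {PY : B → B → ℝ≥0∞} {μY : Measure (ℤ → B)}
    {f : A → C} {g : B → C} {ν : Measure ((ℤ → A) × (ℤ → B))}
    (hν : IsRelIndepCoupling ν μX μY (pathMap f) (pathMap g))
    (hX : IsStatMarkovChainZ πX PX μX) (hY : IsStatMarkovChainZ πY PY μY)
    (t : ℤ) (k : ℕ) (a : ℕ → A) (b : ℕ → B) :
    ν ({ω | ∀ i ≤ k, ω (t + (i : ℤ)) = a i} ×ˢ {ω | ∀ i ≤ k, ω (t + (i : ℤ)) = b i}) =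
      ν ({ω | ∀ i ≤ k, ω (0 + (i : ℤ)) = a i} ×ˢ {ω | ∀ i ≤ k, ω (0 + (i : ℤ)) = b i}) := by
  have := hX.1
  have := hY.1
  have h := hν.preimage_prod (measurable_pathMap (measurable_of_countable f))
    (measurable_pathMap (measurable_of_countable g))
    (σ₁ := fun ω s => ω (t + s)) (σ₂ := fun ω s => ω (t + s))
    (σ' := fun ω s => ω (t + s)) (τ' := fun ω s => ω (-t + s))
    (by fun_prop) (by fun_prop) (by fun_prop) (by fun_prop)
    (fun z => by funext s; simp) (hX.map_shift t) (hY.map_shift t) (fun _ => rfl) (fun _ => rfl)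
    (measurableSet_cylinder_int 0 k a) (measurableSet_cylinder_int 0 k b)
  rw [← h]
  simp only [Set.preimage_ofPred_eq, zero_add]

lemma condIndepGiven_of_isFactorDensity {Ω γ α β : Type*} [MeasurableSpace Ω] [MeasurableSpace γ]
    [MeasurableSpace α] [MeasurableSpace β] {μ : Measure Ω} [IsProbabilityMeasure μ] {Z : Ω → γ}
    {X : Ω → α} {Y : Ω → β} (hZ : Measurable Z) (hX : Measurable X) (hY : Measurable Y)
    (h : ∀ S T, MeasurableSet S → MeasurableSet T → ∃ φ ψ : γ → ℝ≥0∞, (∀ z, φ z ≠ ∞) ∧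
      (∀ z, ψ z ≠ ∞) ∧ IsFactorDensity μ Z (X ⁻¹' S) φ ∧ IsFactorDensity μ Z (Y ⁻¹' T) ψ ∧
      IsFactorDensity μ Z (X ⁻¹' S ∩ Y ⁻¹' T) (fun z => φ z * ψ z)) :
    CondIndepGiven μ Z X Y := by
  rintro _ _ ⟨S, hS, rfl⟩ ⟨T, hT, rfl⟩
  obtain ⟨φ, ψ, hφ, hψ, h1, h2, h12⟩ := h S T hS hT
  filter_upwards [h1.condExp_indic hZ (hX hS) hφ, h2.condExp_indic hZ (hY hT) hψ,
    h12.condExp_indic hZ ((hX hS).inter (hY hT)) fun z => ENNReal.mul_ne_top (hφ z) (hψ z)]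
    with ω e1 e2 e12
  rw [e12, Pi.mul_apply, e1, e2, ENNReal.toReal_mul]

/-- **Stationary coupling.** Stationary time-homogeneous Markov chains indexed by `ℤ` with a
common stationary Markov image chain can be coupled by a stationary time-homogeneous Markov
chain whose coordinates have the given laws, agree after applying `f` and `g` at every time, and
are conditionally independent given the common image process. -/
theorem statement_2
    {A B C : Type*} [Countable A] [Countable B] [Countable C]
    [MeasurableSpace A] [MeasurableSingletonClass A]
    [MeasurableSpace B] [MeasurableSingletonClass B]
    [MeasurableSpace C] [MeasurableSingletonClass C]
    (πX : A → ℝ≥0∞) (PX : A → A → ℝ≥0∞) (μX : Measure (ℤ → A))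
    (πY : B → ℝ≥0∞) (PY : B → B → ℝ≥0∞) (μY : Measure (ℤ → B))
    (πZ : C → ℝ≥0∞) (PZ : C → C → ℝ≥0∞) (μZ : Measure (ℤ → C))
    (f : A → C) (g : B → C)
    (hX : IsStatMarkovChainZ πX PX μX) (hY : IsStatMarkovChainZ πY PY μY)
    (hZ : IsStatMarkovChainZ πZ PZ μZ)
    (hfX : μX.map (fun ω (n : ℤ) => f (ω n)) = μZ)
    (hgY : μY.map (fun ω (n : ℤ) => g (ω n)) = μZ) :
    ∃ (πW : A × B → ℝ≥0∞) (PW : A × B → A × B → ℝ≥0∞) (μW : Measure (ℤ → A × B)),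
      IsStatMarkovChainZ πW PW μW ∧
      μW.map (fun ω (n : ℤ) => (ω n).1) = μX ∧
      μW.map (fun ω (n : ℤ) => (ω n).2) = μY ∧
      (∀ᵐ ω ∂μW, ∀ t : ℤ, f (ω t).1 = g (ω t).2) ∧
      CondIndepGiven μW (fun ω (n : ℤ) => f (ω n).1)
        (fun ω (n : ℤ) => (ω n).1) (fun ω (n : ℤ) => (ω n).2) := by
  have hXp := hX.1
  have hYp := hY.1
  have hfp := measurable_pathMap (ι := ℤ) (measurable_of_countable f)
  have hgp := measurable_pathMap (ι := ℤ) (measurable_of_countable g)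
  replace hfX : μX.map (pathMap f) = μZ := hfX
  replace hgY : μY.map (pathMap g) = μZ := hgY
  have hfg := hfX.trans hgY.symm
  obtain ⟨ν, hνp, hν⟩ := exists_relIndep_coupling μX μY hfp hgp hfg
  replace hν : IsRelIndepCoupling ν μX μY (pathMap f) (pathMap g) := hν
  have hzip := measurable_zipPath (A := A) (B := B)
  have hW : IsProbabilityMeasure (ν.map zipPath) :=
    Measure.isProbabilityMeasure_map hzip.aemeasurable
  have hfst : Measurable fun (ω : ℤ → A × B) (n : ℤ) => (ω n).1 := by fun_prop
  have hsnd : Measurable fun (ω : ℤ → A × B) (n : ℤ) => (ω n).2 := by fun_prop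
  have hrect : ∀ (S : Set (ℤ → A)) (T : Set (ℤ → B)), MeasurableSet S → MeasurableSet T →
      ν.map zipPath ((fun ω n => (ω n).1) ⁻¹' S ∩ (fun ω n => (ω n).2) ⁻¹' T) = ν (S ×ˢ T) := by
    intro S T hS hT
    rw [Measure.map_apply hzip ((hfst hS).inter (hsnd hT))]
    rfl
  have hmapX : (ν.map zipPath).map (fun (ω : ℤ → A × B) (n : ℤ) => (ω n).1) = μX := by
    rw [Measure.map_map hfst hzip]
    exact hν.map_fst hfp
  have hmapY : (ν.map zipPath).map (fun (ω : ℤ → A × B) (n : ℤ) => (ω n).2) = μY := by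
    rw [Measure.map_map hsnd hzip]
    exact hν.map_snd hgp hfg
  have hcyl : ∀ (t : ℤ) (k : ℕ) (a : ℕ → A × B),
      ν.map zipPath {ω | ∀ i ≤ k, ω (t + (i : ℤ)) = a i} =
        ν ({ω | ∀ i ≤ k, ω (t + (i : ℤ)) = (a i).1} ×ˢ
          {ω | ∀ i ≤ k, ω (t + (i : ℤ)) = (a i).2}) := by
    intro t k a
    rw [← hrect _ _ (measurableSet_cylinder_int t k _) (measurableSet_cylinder_int t k _)]
    congr 1
    ext ω
    simp only [Set.mem_ofPred_eq, Set.mem_inter_iff, Set.mem_preimage, Prod.ext_iff, forall_and]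
  obtain ⟨πW, PW, hπW⟩ := exists_isStatMarkovChainZ (ν.map zipPath)
    (fun t k a => by rw [hcyl, hcyl, hν.cylinder_shift hX hY])
    (fun t k a => by
      have hA : MeasurableSet
          {ω : ℤ → A | ω (t + k) = (a k).1 ∧ ω (t + k + 1) = (a (k + 1)).1} :=
        (measurableSet_eval_eq _ _).inter (measurableSet_eval_eq _ _)
      have hB : MeasurableSet
          {ω : ℤ → B | ω (t + k) = (a k).2 ∧ ω (t + k + 1) = (a (k + 1)).2} :=
        (measurableSet_eval_eq _ _).inter (measurableSet_eval_eq _ _)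
      have h := hν.cylinder_mul hX hY hZ hfX hgY t k (fun i => (a i).1) (fun i => (a i).2)
      rw [← hcyl, ← hcyl, ← hrect _ _ (measurableSet_eval_eq _ _) (measurableSet_eval_eq _ _),
        ← hrect _ _ hA hB] at h
      convert h using 3
      · ext ω
        simp only [Set.mem_ofPred_eq, Set.mem_inter_iff, Set.mem_preimage, Prod.ext_iff]
      · ext ω
        simp only [Set.mem_ofPred_eq, Set.mem_inter_iff, Set.mem_preimage, Prod.ext_iff]
        tauto)
  refine ⟨πW, PW, ν.map zipPath, hπW, hmapX, hmapY, ?_, ?_⟩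
  · rw [ae_all_iff]
    intro t
    have hnull : ∀ c c' : C, c ≠ c' →
        ∀ᵐ ω ∂(ν.map zipPath), ¬ (f (ω t).1 = c ∧ g (ω t).2 = c') := by
      intro c c' hc
      have h0 := hν.preimage_prod_preimage hfp hgp (measurableSet_eval_eq t c)
        (measurableSet_eval_eq t c') (Set.disjoint_left.2 fun z hz hz' => hc (hz.symm.trans hz'))
      rw [← hrect _ _ (hfp (measurableSet_eval_eq t c)) (hgp (measurableSet_eval_eq t c'))] at h0
      rw [ae_iff]
      simp only [not_not]
      exact h0
    have hall : ∀ᵐ ω ∂(ν.map zipPath), ∀ c c' : C, c ≠ c' →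
        ¬ (f (ω t).1 = c ∧ g (ω t).2 = c') := by
      rw [ae_all_iff]
      intro c
      rw [ae_all_iff]
      intro c'
      by_cases hc : c = c'
      · exact ae_of_all _ fun ω h => absurd hc h
      · filter_upwards [hnull c c' hc] with ω hω _ using hω
    filter_upwards [hall] with ω hω
    by_contra hne
    exact hω _ _ hne ⟨rfl, rfl⟩
  · have hZm : Measurable fun (ω : ℤ → A × B) (n : ℤ) => f (ω n).1 := hfp.comp hfst
    have hmapZ : (ν.map zipPath).map (fun (ω : ℤ → A × B) (n : ℤ) => f (ω n).1) =
        μX.map (pathMap f) := by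
      rw [← hmapX, Measure.map_map hfp hfst]
      rfl
    have hden : ∀ S T φ ψ, MeasurableSet S → MeasurableSet T →
        IsFactorDensity μX (pathMap f) S φ → IsFactorDensity μY (pathMap g) T ψ →
        IsFactorDensity (ν.map zipPath) (fun ω n => f (ω n).1)
          ((fun ω n => (ω n).1) ⁻¹' S ∩ (fun ω n => (ω n).2) ⁻¹' T) (fun z => φ z * ψ z) := by
      intro S T φ ψ hS hT hφ hψ
      refine .of_setLIntegral_eq hZm (hφ.1.mul hψ.1) fun D hD => ?_
      have h := hν _ _ _ _ (hS.inter (hfp hD)) hT (hφ.inter_preimage hfp hD) hψ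
      rw [← hrect _ _ (hS.inter (hfp hD)) hT] at h
      simp_rw [← Set.indicator_mul_left D φ ψ] at h
      rw [lintegral_indicator hD] at h
      rw [hmapZ, ← h]
      congr 1
      ext ω
      simp only [Set.mem_inter_iff, Set.mem_preimage]
      tauto
    refine condIndepGiven_of_isFactorDensity hZm hfst hsnd fun S T hS hT => ?_
    obtain ⟨φ, hφ, hφt⟩ := exists_isFactorDensity (μ := μX) hfp hS
    obtain ⟨ψ, hψ, hψt⟩ := exists_isFactorDensity (μ := μY) hgp hT
    refine ⟨φ, ψ, hφt, hψt, ?_, ?_, hden S T φ ψ hS hT hφ hψ⟩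
    · simpa using hden S Set.univ φ 1 hS .univ hφ .univ
    · simpa using hden Set.univ T 1 ψ .univ hT .univ hψ
end
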